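/- Let X and Y be normal color Hopf subalgebras of a cocommutative color Hopf algebra A. Then the commutator subalgebra [X,Y] (generated by [x,y] := φ(|x₂|,|y₁|) x₁ y₁ S(x₂) S(y₂)) is normal in A; explicitly, a ▷ [x,y] = φ(|a₂|,|x|) [a₁ ▷ x, a₂ ▷ y] for all homogeneous a ∈ A, x ∈ X, y ∈ Y. -/

import Mathlib

open TensorProduct

namespace ColorHopfPaper

variable (k : Type*) [Field k] (G : Type*) [CommGroup G]

/-- The "middle interchange" map `(A⊗A)⊗(B⊗B) → (A⊗B)⊗(A⊗B)` built from a braiding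
`c : A⊗B → B⊗A` applied to the two middle factors. -/
noncomputable def midMap {A B : Type*} [AddCommGroup A] [Module k A]
    [AddCommGroup B] [Module k B] (c : A ⊗[k] B →ₗ[k] B ⊗[k] A) :
    (A ⊗[k] A) ⊗[k] (B ⊗[k] B) →ₗ[k] (A ⊗[k] B) ⊗[k] (A ⊗[k] B) :=
  (TensorProduct.assoc k A B (A ⊗[k] B)).symm.toLinearMap ∘ₗ
    (TensorProduct.map LinearMap.id
      ((TensorProduct.assoc k B A B).toLinearMap ∘ₗ
        (TensorProduct.map c LinearMap.id) ∘ₗ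
        (TensorProduct.assoc k A B B).symm.toLinearMap)) ∘ₗ
    (TensorProduct.assoc k A A (B ⊗[k] B)).toLinearMap


/-- Generic Hopf kernel `{x : x₁ ⊗ f(x₂) = x ⊗ 1}` of `f`, for a comultiplication `Δ`. -/
noncomputable def hkerGen {X B : Type*} [AddCommGroup X] [Module k X]
    [AddCommGroup B] [Module k B]
    (Δ : X →ₗ[k] X ⊗[k] X) (f : X →ₗ[k] B) (oneB : B) : Submodule k X :=
  LinearMap.ker (((TensorProduct.map LinearMap.id f) ∘ₗ Δ) -
    (TensorProduct.mk k X B).flip oneB)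

/-- A (cocommutative) color Hopf algebra: a cocommutative Hopf monoid in the symmetric
monoidal category of `G`-graded `k`-vector spaces, with braiding given by a
skew-symmetric bicharacter `φ`. -/
structure ColorHopfAlg (H : Type*) [AddCommGroup H] [Module k H] where
  φ : G → G → k
  φ_ne : ∀ g h : G, φ g h ≠ 0
  φ_mul_left : ∀ g h l : G, φ (g * h) l = φ g l * φ h l
  φ_mul_right : ∀ g h l : G, φ g (h * l) = φ g h * φ g l
  φ_skew : ∀ g h : G, φ g h * φ h g = 1
  grade : G → Submodule k H
  grade_top : ⨆ g : G, grade g = ⊤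
  mul : H ⊗[k] H →ₗ[k] H
  one : H
  comul : H →ₗ[k] H ⊗[k] H
  counit : H →ₗ[k] k
  antipode : H →ₗ[k] H
  braid : H ⊗[k] H →ₗ[k] H ⊗[k] H
  braid_apply : ∀ (g h : G) (x y : H), x ∈ grade g → y ∈ grade h →
    braid (x ⊗ₜ[k] y) = φ g h • (y ⊗ₜ[k] x)
  one_mem : one ∈ grade 1
  mul_mem : ∀ (g h : G) (x y : H), x ∈ grade g → y ∈ grade h →
    mul (x ⊗ₜ[k] y) ∈ grade (g * h)
  antipode_mem : ∀ (g : G) (x : H), x ∈ grade g → antipode x ∈ grade g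
  mul_assoc' : ∀ x y z : H,
    mul (mul (x ⊗ₜ[k] y) ⊗ₜ[k] z) = mul (x ⊗ₜ[k] mul (y ⊗ₜ[k] z))
  one_mul' : ∀ x : H, mul (one ⊗ₜ[k] x) = x
  mul_one' : ∀ x : H, mul (x ⊗ₜ[k] one) = x
  coassoc : (TensorProduct.assoc k H H H).toLinearMap ∘ₗ
      (TensorProduct.map comul LinearMap.id) ∘ₗ comul
      = (TensorProduct.map LinearMap.id comul) ∘ₗ comul
  counit_left : ∀ x : H,
    (TensorProduct.lid k H) ((TensorProduct.map counit LinearMap.id) (comul x)) = x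
  counit_right : ∀ x : H,
    (TensorProduct.rid k H) ((TensorProduct.map LinearMap.id counit) (comul x)) = x
  comul_one : comul one = one ⊗ₜ[k] one
  counit_one : counit one = 1
  counit_mul : ∀ x y : H, counit (mul (x ⊗ₜ[k] y)) = counit x * counit y
  comul_mul : comul ∘ₗ mul =
    (TensorProduct.map mul mul) ∘ₗ midMap k braid ∘ₗ (TensorProduct.map comul comul)
  cocomm : braid ∘ₗ comul = comul
  antipode_left : ∀ x : H,
    mul ((TensorProduct.map antipode LinearMap.id) (comul x)) = counit x • one
  antipode_right : ∀ x : H,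
    mul ((TensorProduct.map LinearMap.id antipode) (comul x)) = counit x • one

namespace ColorHopfAlg

variable {k G}
variable {H : Type*} [AddCommGroup H] [Module k H] (C : ColorHopfAlg k G H)

/-- An element is homogeneous if it lies in one of the graded components. -/
def homogeneous (x : H) : Prop := ∃ g : G, x ∈ C.grade g

/-- The (color) adjoint action `ξ(a ⊗ b) = φ(|a₂|,|b|) a₁ b S(a₂)`. -/
noncomputable def adj : H ⊗[k] H →ₗ[k] H :=
  C.mul ∘ₗ
    (TensorProduct.map LinearMap.id
      (C.mul ∘ₗ (TensorProduct.map LinearMap.id C.antipode) ∘ₗ C.braid)) ∘ₗ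
    (TensorProduct.assoc k H H H).toLinearMap ∘ₗ
    (TensorProduct.map C.comul LinearMap.id)

/-- The commutator `[x,y] = φ(|x₂|,|y₁|) x₁y₁S(x₂)S(y₂) = (x ▷ y₁) S(y₂)`. -/
noncomputable def commMap : H ⊗[k] H →ₗ[k] H :=
  C.mul ∘ₗ (TensorProduct.map C.adj C.antipode) ∘ₗ
    (TensorProduct.assoc k H H H).symm.toLinearMap ∘ₗ
    (TensorProduct.map LinearMap.id C.comul)

/-- The comultiplication of the tensor-product (product) coalgebra `H ⊗ H`:
`x ⊗ y ↦ φ(|x₂|,|y₁|) (x₁⊗y₁)⊗(x₂⊗y₂)`. -/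
noncomputable def comul2 : H ⊗[k] H →ₗ[k] (H ⊗[k] H) ⊗[k] (H ⊗[k] H) :=
  midMap k C.braid ∘ₗ TensorProduct.map C.comul C.comul

/-- The counit of the tensor-product coalgebra `H ⊗ H`. -/
noncomputable def counit2 : H ⊗[k] H →ₗ[k] k :=
  (TensorProduct.lid k k).toLinearMap ∘ₗ TensorProduct.map C.counit C.counit

/-- `V` is a (graded) color Hopf subalgebra of `H`. -/
structure IsCHSub (V : Submodule k H) : Prop where
  one_mem : C.one ∈ V
  mul_mem : ∀ x ∈ V, ∀ y ∈ V, C.mul (x ⊗ₜ[k] y) ∈ V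
  comul_mem : ∀ x ∈ V,
    C.comul x ∈ LinearMap.range (TensorProduct.map V.subtype V.subtype)
  antipode_mem : ∀ x ∈ V, C.antipode x ∈ V
  graded : ∀ x ∈ V, x ∈ Submodule.span k {y : H | y ∈ V ∧ ∃ g : G, y ∈ C.grade g}

/-- `V` is normal: closed under the adjoint action of all of `H`. -/
def IsNormal (V : Submodule k H) : Prop :=
  ∀ a : H, ∀ x ∈ V, C.adj (a ⊗ₜ[k] x) ∈ V

/-- The subalgebra (as a submodule) generated by a set. -/
def genFrom (Sgen : Set H) : Submodule k H :=
  sInf {V : Submodule k H |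
    Sgen ⊆ ↑V ∧ C.one ∈ V ∧ ∀ x ∈ V, ∀ y ∈ V, C.mul (x ⊗ₜ[k] y) ∈ V}

/-- The commutator subalgebra `[X,Y]`, generated by all `[x,y]` with `x ∈ V`, `y ∈ W`. -/
def commSub (V W : Submodule k H) : Submodule k H :=
  C.genFrom {z : H | ∃ x ∈ V, ∃ y ∈ W, z = C.commMap (x ⊗ₜ[k] y)}

/-- The graded subspace `VW` spanned by products `vw`. -/
def prodSpan (V W : Submodule k H) : Submodule k H :=
  Submodule.span k {z : H | ∃ x ∈ V, ∃ y ∈ W, z = C.mul (x ⊗ₜ[k] y)}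

/-- The Hopf kernel `Hker(f) = {x : x₁ ⊗ f(x₂) = x ⊗ 1}` of a map `f : H → B`. -/
noncomputable def hkerOf {B : Type*} [AddCommGroup B] [Module k B]
    (CB : ColorHopfAlg k G B) (f : H →ₗ[k] B) : Submodule k H :=
  LinearMap.ker
    (((TensorProduct.map LinearMap.id f) ∘ₗ C.comul) -
      (TensorProduct.mk k H B).flip CB.one)

end ColorHopfAlg

/-- A morphism of color Hopf algebras. -/
structure IsColorHom {A B : Type*} [AddCommGroup A] [Module k A]
    [AddCommGroup B] [Module k B]
    (CA : ColorHopfAlg k G A) (CB : ColorHopfAlg k G B) (f : A →ₗ[k] B) : Prop where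
  map_mul : ∀ x y : A, f (CA.mul (x ⊗ₜ[k] y)) = CB.mul (f x ⊗ₜ[k] f y)
  map_one : f CA.one = CB.one
  map_comul : CB.comul ∘ₗ f = (TensorProduct.map f f) ∘ₗ CA.comul
  map_counit : CB.counit ∘ₗ f = CA.counit
  map_grade : ∀ g : G, ∀ x ∈ CA.grade g, f x ∈ CB.grade g

/-- A color Hopf crossed module `(A, H, d)`. -/
structure ColorCrossedMod {A H : Type*} [AddCommGroup A] [Module k A]
    [AddCommGroup H] [Module k H]
    (CA : ColorHopfAlg k G A) (CH : ColorHopfAlg k G H) where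
  cAH : A ⊗[k] H →ₗ[k] H ⊗[k] A
  cHA : H ⊗[k] A →ₗ[k] A ⊗[k] H
  cAH_apply : ∀ (g h : G) (a : A) (x : H), a ∈ CA.grade g → x ∈ CH.grade h →
    cAH (a ⊗ₜ[k] x) = CA.φ g h • (x ⊗ₜ[k] a)
  cHA_apply : ∀ (g h : G) (x : H) (a : A), x ∈ CH.grade g → a ∈ CA.grade h →
    cHA (x ⊗ₜ[k] a) = CH.φ g h • (a ⊗ₜ[k] x)
  φ_eq : CH.φ = CA.φ
  act : A ⊗[k] H →ₗ[k] H
  act_one_left : ∀ x : H, act (CA.one ⊗ₜ[k] x) = x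
  act_act : ∀ (a b : A) (x : H),
    act (a ⊗ₜ[k] act (b ⊗ₜ[k] x)) = act (CA.mul (a ⊗ₜ[k] b) ⊗ₜ[k] x)
  act_one : ∀ a : A, act (a ⊗ₜ[k] CH.one) = CA.counit a • CH.one
  counit_act : ∀ (a : A) (x : H),
    CH.counit (act (a ⊗ₜ[k] x)) = CA.counit a * CH.counit x
  comul_act : CH.comul ∘ₗ act =
    (TensorProduct.map act act) ∘ₗ midMap k cAH ∘ₗ
      (TensorProduct.map CA.comul CH.comul)
  act_mul : act ∘ₗ (TensorProduct.map LinearMap.id CH.mul) =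
    CH.mul ∘ₗ (TensorProduct.map act act) ∘ₗ midMap k cAH ∘ₗ
      (TensorProduct.map CA.comul LinearMap.id)
  act_grade : ∀ (g h : G) (a : A) (x : H), a ∈ CA.grade g → x ∈ CH.grade h →
    act (a ⊗ₜ[k] x) ∈ CH.grade (g * h)
  d : H →ₗ[k] A
  d_hom : IsColorHom k G CH CA d
  peiffer₁ : d ∘ₗ act = CA.adj ∘ₗ (TensorProduct.map LinearMap.id d)
  peiffer₂ : act ∘ₗ (TensorProduct.map d LinearMap.id) = CH.adj

namespace ColorCrossedMod

variable {k G}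
variable {A H : Type*} [AddCommGroup A] [Module k A] [AddCommGroup H] [Module k H]
variable {CA : ColorHopfAlg k G A} {CH : ColorHopfAlg k G H}

/-- The multiplication of the semi-direct (smash) product `H ⋊ A`:
`(h⊗a)(h'⊗a') = φ(|a₂|,|h'|) h (a₁·h') ⊗ a₂a'`. -/
noncomputable def smashMul (M : ColorCrossedMod k G CA CH) : (H ⊗[k] A) ⊗[k] (H ⊗[k] A) →ₗ[k] H ⊗[k] A :=
  (TensorProduct.map CH.mul CA.mul) ∘ₗ
  (TensorProduct.assoc k (H ⊗[k] H) A A).toLinearMap ∘ₗ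
  (TensorProduct.map (TensorProduct.assoc k H H A).symm.toLinearMap LinearMap.id) ∘ₗ
  (TensorProduct.map
    (TensorProduct.map LinearMap.id (TensorProduct.map M.act LinearMap.id))
    LinearMap.id) ∘ₗ
  (TensorProduct.map
    ((TensorProduct.map LinearMap.id
        ((TensorProduct.assoc k A H A).symm.toLinearMap ∘ₗ
          (TensorProduct.map LinearMap.id M.cAH) ∘ₗ
          (TensorProduct.assoc k A A H).toLinearMap)) ∘ₗ
      (TensorProduct.assoc k H (A ⊗[k] A) H).toLinearMap)
    LinearMap.id) ∘ₗ
  (TensorProduct.assoc k (H ⊗[k] (A ⊗[k] A)) H A).symm.toLinearMap ∘ₗ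
  (TensorProduct.map (TensorProduct.map LinearMap.id CA.comul) LinearMap.id)

/-- The comultiplication of `H ⋊ A` (tensor-product coalgebra twisted by `φ`). -/
noncomputable def smashComul (M : ColorCrossedMod k G CA CH) : H ⊗[k] A →ₗ[k] (H ⊗[k] A) ⊗[k] (H ⊗[k] A) :=
  midMap k M.cHA ∘ₗ TensorProduct.map CH.comul CA.comul

/-- The counit of `H ⋊ A`. -/
noncomputable def smashCounit (_M : ColorCrossedMod k G CA CH) : H ⊗[k] A →ₗ[k] k :=
  (TensorProduct.lid k k).toLinearMap ∘ₗ TensorProduct.map CH.counit CA.counit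

end ColorCrossedMod


section Part1
set_option linter.unusedSimpArgs false
/-- Sweedler sum relative to a basis: `∑ F(a₁, a₂)` for an arbitrary function on basis indices. -/
noncomputable def swr {k ι H M : Type*} [Field k] [AddCommGroup H] [Module k H]
    [AddCommGroup M] [Module k M] (e : Module.Basis ι k H) (Δ : H →ₗ[k] H ⊗[k] H)
    (F : ι → ι → M) : H →ₗ[k] M :=
  ((e.tensorProduct e).constr k (fun p : ι × ι => F p.1 p.2)) ∘ₗ Δ

structure Cal (k ι H : Type*) [Field k] [Ring H] [Algebra k H] where
  e : Module.Basis ι k H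
  φ : ι → ι → k
  skew : ∀ i j, φ i j * φ j i = 1
  χ : ι → H →ₐ[k] H
  ψ : ι → H →ₐ[k] H
  χ_e : ∀ i j, χ i (e j) = φ i j • e j
  ψ_e : ∀ i j, ψ i (e j) = φ j i • e j
  Δ : H →ₗ[k] H ⊗[k] H
  S : H →ₗ[k] H
  ε : H →ₗ[k] k
  S_χ : ∀ i x, S (χ i x) = χ i (S x)
  coassoc0 : (TensorProduct.assoc k H H H).toLinearMap ∘ₗ
      (TensorProduct.map Δ LinearMap.id) ∘ₗ Δ
      = (TensorProduct.map LinearMap.id Δ) ∘ₗ Δ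
  counit_left0 : ∀ x : H,
    (TensorProduct.lid k H) ((TensorProduct.map ε LinearMap.id) (Δ x)) = x
  counit_right0 : ∀ x : H,
    (TensorProduct.rid k H) ((TensorProduct.map LinearMap.id ε) (Δ x)) = x
  comul_one : Δ 1 = 1 ⊗ₜ[k] 1
  counit_one : ε 1 = 1
  counit_mul : ∀ x y : H, ε (x * y) = ε x * ε y
  comul_mul0 : ∀ a b : H, Δ (a * b) = swr e Δ (fun i j => swr e Δ (fun p q =>
    (e i * χ j (e p)) ⊗ₜ[k] (e j * e q)) b) a
  cocomm0 : ∀ a, Δ a = swr e Δ (fun i j => φ i j • (e j ⊗ₜ[k] e i)) a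
  antipode_left0 : ∀ x : H,
    swr e Δ (fun i j => S (e i) * e j) x = ε x • (1 : H)
  antipode_right0 : ∀ x : H,
    swr e Δ (fun i j => e i * S (e j)) x = ε x • (1 : H)

namespace Cal

variable {k ι H : Type*} [Field k] [Ring H] [Algebra k H] (D : Cal k ι H)
variable {M N : Type*} [AddCommGroup M] [Module k M] [AddCommGroup N] [Module k N]

noncomputable def sw (F : ι → ι → M) : H →ₗ[k] M := swr D.e D.Δ F

theorem sw_tmul_gen (f : H ⊗[k] H →ₗ[k] M) (a : H) :
    f (D.Δ a) = D.sw (fun i j => f (D.e i ⊗ₜ[k] D.e j)) a := by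
  unfold sw swr
  have : (D.e.tensorProduct D.e).constr k
      (fun p : ι × ι => f (D.e p.1 ⊗ₜ[k] D.e p.2)) = f := by
    apply (D.e.tensorProduct D.e).ext
    rintro ⟨i, j⟩
    rw [Module.Basis.constr_basis]; simp
  rw [this]; rfl

theorem Δ_sw (a : H) : D.Δ a = D.sw (fun i j => D.e i ⊗ₜ[k] D.e j) a :=
  D.sw_tmul_gen LinearMap.id a

theorem map_sw (g : M →ₗ[k] N) (F : ι → ι → M) (a : H) :
    g (D.sw F a) = D.sw (fun i j => g (F i j)) a := by
  unfold sw swr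
  have : g ∘ₗ (D.e.tensorProduct D.e).constr k (fun p : ι × ι => F p.1 p.2) =
      (D.e.tensorProduct D.e).constr k (fun p : ι × ι => g (F p.1 p.2)) := by
    apply (D.e.tensorProduct D.e).ext
    rintro ⟨i, j⟩
    rw [LinearMap.comp_apply, Module.Basis.constr_basis, Module.Basis.constr_basis]
  rw [← this]; rfl

theorem sw_eq (F : ι → ι → M) (a : H) :
    D.sw F a = ((D.e.tensorProduct D.e).repr (D.Δ a)).sum (fun p c => c • F p.1 p.2) := by
  unfold sw swr
  rw [LinearMap.comp_apply, Module.Basis.constr_apply]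

theorem sw_swap (F : ι → ι → ι → ι → M) (a b : H) :
    D.sw (fun i j => D.sw (fun p q => F i j p q) b) a =
      D.sw (fun p q => D.sw (fun i j => F i j p q) a) b := by
  simp only [sw_eq, Finsupp.sum, Finset.smul_sum]
  rw [Finset.sum_comm]
  refine Finset.sum_congr rfl fun _ _ => Finset.sum_congr rfl fun _ _ => ?_
  rw [smul_comm]

theorem sw_congr {F F' : ι → ι → M} (h : ∀ i j, F i j = F' i j) (a : H) :
    D.sw F a = D.sw F' a := by
  have : F = F' := by funext i j; exact h i j
  rw [this]

theorem sw_add (F F' : ι → ι → M) (a : H) :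
    D.sw (fun i j => F i j + F' i j) a = D.sw F a + D.sw F' a := by
  simp only [sw_eq, Finsupp.sum, smul_add, Finset.sum_add_distrib]

theorem smul_sw (c : k) (F : ι → ι → M) (a : H) :
    c • D.sw F a = D.sw (fun i j => c • F i j) a :=
  D.map_sw (LinearMap.lsmul k M c) F a

theorem mul_sw (x : H) (F : ι → ι → H) (a : H) :
    x * D.sw F a = D.sw (fun i j => x * F i j) a :=
  D.map_sw (LinearMap.mulLeft k x) F a

theorem sw_mul (x : H) (F : ι → ι → H) (a : H) :
    D.sw F a * x = D.sw (fun i j => F i j * x) a :=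
  D.map_sw (LinearMap.mulRight k x) F a

theorem χ_sw (l : ι) (F : ι → ι → H) (a : H) :
    D.χ l (D.sw F a) = D.sw (fun i j => D.χ l (F i j)) a :=
  D.map_sw (D.χ l).toLinearMap F a

theorem ψ_sw (l : ι) (F : ι → ι → H) (a : H) :
    D.ψ l (D.sw F a) = D.sw (fun i j => D.ψ l (F i j)) a :=
  D.map_sw (D.ψ l).toLinearMap F a

theorem tmul_sw (x : M) (F : ι → ι → N) (a : H) :
    x ⊗ₜ[k] D.sw F a = D.sw (fun i j => x ⊗ₜ[k] F i j) a :=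
  D.map_sw (TensorProduct.mk k M N x) F a

theorem sw_tmul (x : N) (F : ι → ι → M) (a : H) :
    D.sw F a ⊗ₜ[k] x = D.sw (fun i j => F i j ⊗ₜ[k] x) a :=
  D.map_sw ((TensorProduct.mk k M N).flip x) F a

/-- Linear extension. -/
noncomputable def lin (g : ι → M) : H →ₗ[k] M := D.e.constr k g

@[simp] theorem lin_e (g : ι → M) (i : ι) : D.lin g (D.e i) = g i :=
  D.e.constr_basis k g i

theorem coassoc (F : ι → ι → ι → M) (a : H) :
    D.sw (fun i j => D.sw (fun p q => F p q j) (D.e i)) a =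
      D.sw (fun i j => D.sw (fun p q => F i p q) (D.e j)) a := by
  let f : H ⊗[k] (H ⊗[k] H) →ₗ[k] M :=
    (D.e.tensorProduct (D.e.tensorProduct D.e)).constr k
      (fun p : ι × ι × ι => F p.1 p.2.1 p.2.2)
  have hf : ∀ i j l, f (D.e i ⊗ₜ[k] (D.e j ⊗ₜ[k] D.e l)) = F i j l := by
    intro i j l
    have := (D.e.tensorProduct (D.e.tensorProduct D.e)).constr_basis k
      (fun p : ι × ι × ι => F p.1 p.2.1 p.2.2) (i, j, l)
    simpa using this
  have h := congrArg f (LinearMap.congr_fun D.coassoc0 a)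
  simp only [LinearMap.comp_apply] at h
  rw [D.Δ_sw a] at h
  simp only [map_sw, TensorProduct.map_tmul, LinearMap.id_apply, LinearEquiv.coe_coe] at h
  simp only [D.Δ_sw (D.e _)] at h
  simp only [sw_tmul, tmul_sw, LinearMap.comp_apply, LinearEquiv.coe_coe] at h
  have hA : ∀ (x : H) (j : ι), f ((TensorProduct.assoc k H H H)
      (D.sw (fun p q => (D.e p ⊗ₜ[k] D.e q) ⊗ₜ[k] D.e j) x)) =
      D.sw (fun p q => F p q j) x := by
    intro x j
    have := D.map_sw (f ∘ₗ (TensorProduct.assoc k H H H).toLinearMap)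
      (fun p q => (D.e p ⊗ₜ[k] D.e q) ⊗ₜ[k] D.e j) x
    simpa [hf] using this
  simpa [hA, map_sw, hf] using h

theorem counit_l (g : ι → M) (a : H) :
    D.sw (fun i j => D.ε (D.e i) • g j) a = D.lin g a := by
  have h := congrArg (D.lin g) (D.counit_left0 a)
  have h1 := D.sw_tmul_gen ((D.lin g) ∘ₗ (TensorProduct.lid k H).toLinearMap ∘ₗ
    (TensorProduct.map D.ε LinearMap.id)) a
  simp at h1
  rw [← h, h1]

theorem counit_r (g : ι → M) (a : H) :
    D.sw (fun i j => D.ε (D.e j) • g i) a = D.lin g a := by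
  have h := congrArg (D.lin g) (D.counit_right0 a)
  have h1 := D.sw_tmul_gen ((D.lin g) ∘ₗ (TensorProduct.rid k H).toLinearMap ∘ₗ
    (TensorProduct.map LinearMap.id D.ε)) a
  simp at h1
  rw [← h, h1]

theorem counit_le (g : ι → M) (m : ι) :
    D.sw (fun i j => D.ε (D.e i) • g j) (D.e m) = g m := by
  rw [counit_l, lin_e]

theorem counit_re (g : ι → M) (m : ι) :
    D.sw (fun i j => D.ε (D.e j) • g i) (D.e m) = g m := by
  rw [counit_r, lin_e]

theorem counit_ll (g : H →ₗ[k] M) (a : H) :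
    D.sw (fun i j => D.ε (D.e i) • g (D.e j)) a = g a := by
  rw [counit_l D (fun j => g (D.e j))]
  congr 1
  apply D.e.ext; simp

theorem counit_rl (g : H →ₗ[k] M) (a : H) :
    D.sw (fun i j => D.ε (D.e j) • g (D.e i)) a = g a := by
  rw [counit_r D (fun j => g (D.e j))]
  congr 1
  apply D.e.ext; simp

/-- a bilinear-looking function on indices extended to the tensor square -/
noncomputable def bil (F : ι → ι → M) : H ⊗[k] H →ₗ[k] M :=
  (D.e.tensorProduct D.e).constr k (fun p : ι × ι => F p.1 p.2)

@[simp] theorem bil_e (F : ι → ι → M) (i j : ι) :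
    D.bil F (D.e i ⊗ₜ[k] D.e j) = F i j := by
  have := (D.e.tensorProduct D.e).constr_basis k (fun p : ι × ι => F p.1 p.2) (i, j)
  simpa [bil] using this

theorem sw_bil (F : ι → ι → M) (a : H) : D.sw F a = D.bil F (D.Δ a) := rfl

theorem cocomm (F : ι → ι → M) (a : H) :
    D.sw F a = D.sw (fun i j => D.φ i j • F j i) a := by
  rw [sw_bil, D.cocomm0 a]
  change (D.bil F) (D.sw _ a) = _
  rw [map_sw]; simp

theorem antipode_l (a : H) : D.sw (fun i j => D.S (D.e i) * D.e j) a = D.ε a • (1 : H) :=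
  D.antipode_left0 a

theorem antipode_r (a : H) : D.sw (fun i j => D.e i * D.S (D.e j)) a = D.ε a • (1 : H) :=
  D.antipode_right0 a

theorem comul_mul (a b : H) : D.Δ (a * b) = D.sw (fun i j => D.sw (fun p q =>
    (D.e i * D.χ j (D.e p)) ⊗ₜ[k] (D.e j * D.e q)) b) a := D.comul_mul0 a b

/-- bilinear functional applied to `Δ(ab)` -/
theorem sw_ab (f : H →ₗ[k] H →ₗ[k] M) (a b : H) :
    D.sw (fun i j => f (D.e i) (D.e j)) (a * b) = D.sw (fun i j => D.sw (fun p q =>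
    f (D.e i * D.χ j (D.e p)) (D.e j * D.e q)) b) a := by
  have h := D.sw_tmul_gen (TensorProduct.lift f) (a * b)
  simp only [TensorProduct.lift.tmul] at h
  rw [← h, comul_mul]; simp only [map_sw, TensorProduct.lift.tmul]

theorem sw_f (f : H →ₗ[k] H →ₗ[k] M) (a : H) :
    D.sw (fun i j => f (D.e i) (D.e j)) a = TensorProduct.lift f (D.Δ a) := by
  have h := D.sw_tmul_gen (TensorProduct.lift f) a
  simpa using h.symm

theorem sw_one (f : H →ₗ[k] H →ₗ[k] M) :
    D.sw (fun i j => f (D.e i) (D.e j)) 1 = f 1 1 := by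
  rw [sw_f, comul_one]; simp

/-! diagonal automorphisms -/
theorem φne (i j : ι) : D.φ i j ≠ 0 := left_ne_zero_of_mul_eq_one (D.skew i j)

theorem ψχ (i : ι) (x : H) : D.ψ i (D.χ i x) = x := by
  have : (D.ψ i).toLinearMap ∘ₗ (D.χ i).toLinearMap = LinearMap.id := by
    apply D.e.ext; intro j
    simp [D.χ_e, D.ψ_e, smul_smul, D.skew]
  exact LinearMap.congr_fun this x

theorem χψ (i : ι) (x : H) : D.χ i (D.ψ i x) = x := by
  have : (D.χ i).toLinearMap ∘ₗ (D.ψ i).toLinearMap = LinearMap.id := by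
    apply D.e.ext; intro j
    simp [D.χ_e, D.ψ_e, smul_smul, D.skew]
  exact LinearMap.congr_fun this x

theorem S_ψ (i : ι) (x : H) : D.S (D.ψ i x) = D.ψ i (D.S x) := by
  rw [← D.ψχ i (D.S (D.ψ i x)), ← S_χ, χψ]

end Cal
end Part1

section Part2
set_option linter.unusedSimpArgs false
namespace Cal
variable {k ι H : Type*} [Field k] [Ring H] [Algebra k H] (D : Cal k ι H)
variable {M N : Type*} [AddCommGroup M] [Module k M] [AddCommGroup N] [Module k N]

theorem smul_one_e (m : ι) (x : H) : D.ε (D.e m) • x =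
   D.sw (fun i j => D.e i * D.S (D.e j)) (D.e m) * x := by
  rw [antipode_r]; simp

noncomputable def gg (a : H) : H →ₗ[k] H :=
  D.sw (fun i j => (LinearMap.mulRight k (D.e j)) ∘ₗ D.S ∘ₗ
    (LinearMap.mulLeft k (D.e i)) ∘ₗ (D.χ j).toLinearMap) a

theorem gg_apply (a y : H) : D.gg a y = D.sw (fun i j => D.S (D.e i * D.χ j y) * D.e j) a := by
  unfold gg
  have := D.map_sw (LinearMap.applyₗ y : (H →ₗ[k] H) →ₗ[k] H)
    (fun i j => (LinearMap.mulRight k (D.e j)) ∘ₗ D.S ∘ₗ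
    (LinearMap.mulLeft k (D.e i)) ∘ₗ (D.χ j).toLinearMap) a
  simpa using this

theorem gg_conv (a y : H) : D.sw (fun p q => D.gg a (D.e p) * D.e q) y = (D.ε a * D.ε y) • 1 := by
  have h := D.antipode_l (a * y)
  rw [D.counit_mul] at h
  rw [← h]
  have h2 := D.sw_ab ((LinearMap.mul k H) ∘ₗ D.S) a y
  simp only [LinearMap.comp_apply, LinearMap.mul_apply'] at h2
  rw [h2, sw_swap]
  simp only [gg_apply, sw_mul, mul_assoc]

theorem gg_eq (a y : H) : D.gg a y = D.ε a • D.S y := by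
  rw [← D.counit_rl (D.gg a) y]
  have h : D.sw (fun i j => D.ε (D.e j) • D.gg a (D.e i)) y
      = D.sw (fun i j => D.sw (fun p q => D.gg a (D.e i) * D.e p * D.S (D.e q)) (D.e j)) y := by
    apply sw_congr; intro i j
    rw [← mul_one (D.gg a (D.e i)), ← mul_smul_comm, ← antipode_r, mul_sw]
    simp only [mul_assoc, one_mul]
  rw [h, ← D.coassoc (fun i p q => D.gg a (D.e i) * D.e p * D.S (D.e q))]
  simp only [← sw_mul, gg_conv]
  have h9 := D.counit_ll (D.ε a • D.S) y
  simp only [LinearMap.smul_apply] at h9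
  rw [← h9]
  apply sw_congr; intro i j
  simp [smul_smul, mul_comm]

theorem S_anti_e (j m : ι) : D.S (D.e j * D.e m) = D.φ j m • (D.S (D.e m) * D.S (D.e j)) := by
  have h1 : D.sw (fun i l => D.gg (D.e i) (D.χ l (D.e m)) * D.S (D.e l)) (D.e j) =
     D.φ j m • (D.S (D.e m) * D.S (D.e j)) := by
    simp only [gg_eq]
    rw [← D.counit_le (fun j => D.φ j m • (D.S (D.e m) * D.S (D.e j)))]
    apply sw_congr; intro i l
    simp [D.χ_e, smul_smul]
  rw [← h1]
  simp only [gg_apply, sw_mul]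
  rw [D.coassoc (fun p q l => D.S (D.e p * D.χ q (D.χ l (D.e m))) * D.e q * D.S (D.e l))]
  rw [← D.counit_re (fun j => D.S (D.e j * D.e m))]
  apply sw_congr; intro i l
  have h2 : D.ψ m (D.ε (D.e l) • 1) = D.ε (D.e l) • (1 : H) := by simp
  have h3 := D.antipode_r (D.e l)
  rw [← h3, ψ_sw, h3] at h2
  rw [← mul_one (D.S (D.e i * D.e m)), ← mul_smul_comm, ← h2, mul_sw]
  apply sw_congr; intro p q
  simp only [D.χ_e, D.ψ_e, map_mul, map_smul, ← D.S_ψ, smul_mul_assoc, mul_smul_comm, smul_smul,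
    mul_assoc]

theorem S_anti (j : ι) (y : H) : D.S (D.e j * y) = D.S (D.χ j y) * D.S (D.e j) := by
  have : D.S ∘ₗ LinearMap.mulLeft k (D.e j) =
     LinearMap.mulRight k (D.S (D.e j)) ∘ₗ D.S ∘ₗ (D.χ j).toLinearMap := by
    apply D.e.ext; intro m
    simp [S_anti_e, D.χ_e]
  exact LinearMap.congr_fun this y

theorem S_anti' (j : ι) (y : H) : D.S (y * D.e j) = D.S (D.e j) * D.S (D.ψ j y) := by
  have : D.S ∘ₗ LinearMap.mulRight k (D.e j) =
     LinearMap.mulLeft k (D.S (D.e j)) ∘ₗ D.S ∘ₗ (D.ψ j).toLinearMap := by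
    apply D.e.ext; intro m
    simp [S_anti_e, D.ψ_e]
  exact LinearMap.congr_fun this y

theorem S_one : D.S 1 = 1 := by
  have h := D.antipode_l 1
  have h2 := D.sw_one ((LinearMap.mul k H) ∘ₗ D.S)
  simp only [LinearMap.comp_apply, LinearMap.mul_apply'] at h2
  rw [h2, D.counit_one] at h
  simpa using h

theorem S_SS (a : H) : D.sw (fun i j => D.S (D.e i) * D.S (D.S (D.e j))) a = D.ε a • 1 := by
  have h := congrArg D.S (D.antipode_l a)
  rw [map_sw, map_smul, S_one] at h
  rw [← h, cocomm]
  apply sw_congr; intro i j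
  rw [S_anti']; simp [← D.S_ψ, D.ψ_e]

theorem SS (a : H) : D.S (D.S a) = a := by
  have h1 := D.counit_ll (D.S ∘ₗ D.S) a
  simp only [LinearMap.comp_apply] at h1
  rw [← h1]
  simp only [smul_one_e, sw_mul, mul_assoc]
  rw [D.coassoc (fun p q j => D.e p * (D.S (D.e q) * D.S (D.S (D.e j))))]
  simp only [← mul_sw, S_SS]
  have h2 := D.counit_rl (LinearMap.id) a
  simpa using h2

theorem ε_χ (q : ι) (y : H) : D.ε (D.χ q y) = D.ε y := by
  have h1 : ∀ y, D.sw (fun p r => D.ε (D.χ q (D.e p)) • (D.e q * D.e r)) y = D.e q * y := by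
    intro y
    have h := D.counit_ll LinearMap.id (D.e q * y)
    have h2 := D.sw_ab ((LinearMap.lsmul k H) ∘ₗ D.ε) (D.e q) y
    simp only [LinearMap.comp_apply, LinearMap.lsmul_apply] at h2
    simp only [LinearMap.id_apply] at h
    rw [← h, h2, sw_swap]
    apply sw_congr; intro p r
    simp only [D.counit_mul, mul_smul]
    rw [D.counit_le (fun j => D.ε (D.χ j (D.e p)) • (D.e j * D.e r))]
  have h3 : D.sw (fun i j => D.sw (fun p r => D.ε (D.χ q (D.e p)) • (D.e q * D.e r)) (D.e i)
      * D.S (D.e j)) y = D.ε y • D.e q := by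
    simp only [h1, mul_assoc]
    rw [← mul_sw, antipode_r]; simp
  simp only [sw_mul] at h3
  rw [D.coassoc (fun p r j => D.ε (D.χ q (D.e p)) • (D.e q * D.e r) * D.S (D.e j))] at h3
  simp only [smul_mul_assoc, mul_assoc] at h3
  simp only [← smul_sw, ← mul_sw, antipode_r] at h3
  have h4 := D.counit_rl ((D.ε ∘ₗ (D.χ q).toLinearMap).smulRight (D.e q)) y
  simp only [LinearMap.smulRight_apply, LinearMap.comp_apply, AlgHom.toLinearMap_apply] at h4
  have h5 : D.ε (D.χ q y) • D.e q = D.ε y • D.e q := by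
    rw [← h3, ← h4]
    apply sw_congr; intro i j
    simp [smul_smul, mul_comm]
  exact smul_left_injective k (D.e.ne_zero q) h5

theorem ε_ψ (q : ι) (y : H) : D.ε (D.ψ q y) = D.ε y := by
  rw [← ε_χ D q, χψ]

end Cal
end Part2

section Part3
set_option linter.unusedSimpArgs false
namespace Cal
variable {k ι H : Type*} [Field k] [Ring H] [Algebra k H] (D : Cal k ι H)
variable {M N : Type*} [AddCommGroup M] [Module k M] [AddCommGroup N] [Module k N]

noncomputable def Lam : H ⊗[k] H →ₗ[k] H ⊗[k] H →ₗ[k] H ⊗[k] H :=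
  D.bil (fun i j => TensorProduct.map ((LinearMap.mulLeft k (D.e i)) ∘ₗ (D.χ j).toLinearMap)
    (LinearMap.mulLeft k (D.e j)))

theorem Lam_ee (i j : ι) (x y : H) : D.Lam (D.e i ⊗ₜ D.e j) (x ⊗ₜ y) =
    (D.e i * D.χ j x) ⊗ₜ[k] (D.e j * y) := by
  simp [Lam]

theorem Lam_e (u v : H) (m : ι) (s : H) : D.Lam (u ⊗ₜ v) (D.e m ⊗ₜ s) =
    (u * D.e m) ⊗ₜ[k] (D.ψ m v * s) := by
  have : (LinearMap.applyₗ (D.e m ⊗ₜ s : H ⊗[k] H)) ∘ₗ D.Lam =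
      TensorProduct.map (LinearMap.mulRight k (D.e m))
        ((LinearMap.mulRight k s) ∘ₗ (D.ψ m).toLinearMap) := by
    apply (D.e.tensorProduct D.e).ext
    rintro ⟨i, j⟩
    simp [Lam_ee, D.χ_e, D.ψ_e, smul_tmul]
  have h := LinearMap.congr_fun this (u ⊗ₜ v)
  simpa using h

theorem Lam_S (u : H) (d : ι) (z t : H) : D.Lam (u ⊗ₜ D.S (D.e d)) (z ⊗ₜ t) =
    (u * D.χ d z) ⊗ₜ[k] (D.S (D.e d) * t) := by
  have : D.Lam (u ⊗ₜ D.S (D.e d)) ∘ₗ ((TensorProduct.mk k H H).flip t) =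
      ((TensorProduct.mk k H H).flip (D.S (D.e d) * t)) ∘ₗ (LinearMap.mulLeft k u) ∘ₗ
      (D.χ d).toLinearMap := by
    apply D.e.ext; intro m
    simp [Lam_e, D.χ_e, ← D.S_ψ, D.ψ_e, smul_tmul]
  have h := LinearMap.congr_fun this z
  simpa using h

theorem ten_ext {f g : H ⊗[k] H →ₗ[k] M} (h : ∀ i j, f (D.e i ⊗ₜ D.e j) = g (D.e i ⊗ₜ D.e j)) :
    f = g := by
  apply (D.e.tensorProduct D.e).ext
  rintro ⟨i, j⟩
  simpa using h i j

theorem Lam_assoc (p q r : H ⊗[k] H) : D.Lam (D.Lam p q) r = D.Lam p (D.Lam q r) := by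
  have h1 : ∀ i j l m r, D.Lam (D.Lam (D.e i ⊗ₜ D.e j) (D.e l ⊗ₜ D.e m)) r =
      D.Lam (D.e i ⊗ₜ D.e j) (D.Lam (D.e l ⊗ₜ D.e m) r) := by
    intro i j l m r
    have : D.Lam (D.Lam (D.e i ⊗ₜ D.e j) (D.e l ⊗ₜ D.e m)) =
      D.Lam (D.e i ⊗ₜ D.e j) ∘ₗ (D.Lam (D.e l ⊗ₜ D.e m)) := by
      apply D.ten_ext; intro s t
      simp only [LinearMap.comp_apply, Lam_ee,
        Lam_e, map_mul, D.ψ_e, D.χ_e, smul_mul_assoc, mul_smul_comm, smul_smul, mul_assoc,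
        tmul_smul, ← smul_tmul', map_smul, LinearMap.smul_apply]
      congr 1; ring
    exact LinearMap.congr_fun this r
  have h2 : ∀ i j q r, D.Lam (D.Lam (D.e i ⊗ₜ D.e j) q) r =
      D.Lam (D.e i ⊗ₜ D.e j) (D.Lam q r) := by
    intro i j q r
    have : LinearMap.applyₗ r ∘ₗ D.Lam ∘ₗ (D.Lam (D.e i ⊗ₜ D.e j)) =
      D.Lam (D.e i ⊗ₜ D.e j) ∘ₗ LinearMap.applyₗ r ∘ₗ D.Lam := by
      apply D.ten_ext; intro s t
      exact h1 i j s t r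
    exact LinearMap.congr_fun this q
  have : LinearMap.applyₗ r ∘ₗ D.Lam ∘ₗ LinearMap.applyₗ q ∘ₗ D.Lam =
      LinearMap.applyₗ (D.Lam q r) ∘ₗ D.Lam := by
    apply D.ten_ext; intro s t
    exact h2 s t q r
  exact LinearMap.congr_fun this p

theorem Lam_one_right (p : H ⊗[k] H) : D.Lam p (1 ⊗ₜ 1) = p := by
  have : (LinearMap.applyₗ ((1:H) ⊗ₜ (1:H) : H ⊗[k] H)) ∘ₗ D.Lam = LinearMap.id := by
    apply D.ten_ext; intro i j
    simp [Lam_ee]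
  have h := LinearMap.congr_fun this p
  simpa using h

theorem Lam_one_left (p : H ⊗[k] H) : D.Lam (1 ⊗ₜ 1) p = p := by
  have : D.Lam (1 ⊗ₜ 1) = LinearMap.id := by
    apply D.ten_ext; intro i j
    simp [Lam_e]
  rw [this]; simp

theorem Δ_mul (a b : H) : D.Δ (a * b) = D.Lam (D.Δ a) (D.Δ b) := by
  rw [comul_mul]
  conv_rhs => rw [D.Δ_sw a, D.map_sw D.Lam]
  have := D.map_sw (LinearMap.applyₗ (D.Δ b))
    (fun i j => D.Lam (D.e i ⊗ₜ D.e j)) a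
  simp only [LinearMap.applyₗ_apply_apply] at this
  rw [this]
  apply sw_congr; intro i j
  rw [D.Δ_sw b, map_sw]
  simp only [Lam_ee]

theorem mid4 (F : ι → ι → ι → ι → M) (a : H) :
    D.sw (fun i j => D.sw (fun p q => D.sw (fun r s => F p q r s) (D.e j)) (D.e i)) a =
    D.sw (fun i j => D.sw (fun p q => D.sw (fun u v => F i u v q) (D.e p)) (D.e j)) a := by
  rw [D.coassoc (fun p q j => D.sw (fun r s => F p q r s) (D.e j))]
  apply sw_congr; intro i j
  rw [D.coassoc (fun u v q => F i u v q)]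

theorem mid_swap (F : ι → ι → ι → ι → M) (a : H) :
    D.sw (fun i j => D.sw (fun p q => D.sw (fun r s => F p q r s) (D.e j)) (D.e i)) a =
    D.sw (fun i j => D.sw (fun p q => D.sw (fun r s => D.φ q r • F p r q s) (D.e j)) (D.e i)) a := by
  rw [mid4, D.mid4 (fun p q r s => D.φ q r • F p r q s)]
  apply sw_congr; intro i j
  apply sw_congr; intro p q
  rw [cocomm]

theorem Δ_S (a : H) : D.Δ (D.S a) = TensorProduct.map D.S D.S (D.Δ a) := by
  set G := TensorProduct.map D.S D.S ∘ₗ D.Δ with hG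
  have hGe : ∀ x, G x = D.sw (fun r s => D.S (D.e r) ⊗ₜ D.S (D.e s)) x := by
    intro x; rw [hG, LinearMap.comp_apply, D.Δ_sw, map_sw]; simp
  have app : ∀ (F : ι → ι → (H ⊗[k] H →ₗ[k] H ⊗[k] H)) (x : H) (z : H ⊗[k] H),
      (D.sw F x) z = D.sw (fun i j => F i j z) x := by
    intro F x z
    exact D.map_sw (LinearMap.applyₗ z) F x
  have c1 : ∀ x, D.sw (fun i j => D.Lam (D.Δ (D.e i)) (G (D.e j))) x = D.ε x • (1 ⊗ₜ 1) := by
    intro x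
    have h1 : ∀ i j, D.Lam (D.Δ (D.e i)) (G (D.e j)) = D.sw (fun p q => D.sw (fun r s =>
        D.φ q r • ((D.e p * D.S (D.e r)) ⊗ₜ[k] (D.e q * D.S (D.e s)))) (D.e j)) (D.e i) := by
      intro i j
      rw [hGe, map_sw, D.Δ_sw (D.e i), map_sw, sw_swap]
      apply sw_congr; intro r s
      rw [app]
      apply sw_congr; intro p q
      rw [Lam_ee, ← D.S_χ, D.χ_e]
      simp [smul_tmul]
    simp only [h1]
    rw [mid_swap]
    have h2 : ∀ p q r s, D.φ q r • D.φ r q • ((D.e p * D.S (D.e q)) ⊗ₜ[k] (D.e r * D.S (D.e s)))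
        = ((D.e p * D.S (D.e q)) ⊗ₜ[k] (D.e r * D.S (D.e s))) := by
      intro p q r s; rw [smul_smul, D.skew, one_smul]
    simp only [h2, ← tmul_sw, ← sw_tmul, antipode_r]
    have h3 := D.counit_ll (D.ε.smulRight ((1:H) ⊗ₜ (1:H) : H ⊗[k] H)) x
    simp only [LinearMap.smulRight_apply] at h3
    rw [← h3]
    apply sw_congr; intro i j
    simp [smul_smul, smul_tmul, mul_comm]
  have c2 : ∀ x, D.sw (fun i j => D.Lam (D.Δ (D.S (D.e i))) (D.Δ (D.e j))) x
      = D.ε x • (1 ⊗ₜ 1) := by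
    intro x
    simp only [← Δ_mul]
    rw [← map_sw, antipode_l, map_smul, D.comul_one]
  have h1 := D.counit_rl (D.Δ ∘ₗ D.S) a
  have h2 := D.counit_ll G a
  change D.Δ (D.S a) = G a
  rw [← h2]
  rw [LinearMap.comp_apply] at h1
  rw [← h1]
  have h3 : ∀ i j, D.ε (D.e j) • (D.Δ ∘ₗ D.S) (D.e i) =
      D.sw (fun p q => D.Lam (D.Lam (D.Δ (D.S (D.e i))) (D.Δ (D.e p))) (G (D.e q))) (D.e j) := by
    intro i j
    simp only [Lam_assoc]
    rw [← map_sw, c1, map_smul, Lam_one_right]; rfl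
  simp only [h3]
  rw [← D.coassoc (fun i p q => D.Lam (D.Lam (D.Δ (D.S (D.e i))) (D.Δ (D.e p))) (G (D.e q)))]
  apply sw_congr; intro i j
  rw [← app (fun p q => D.Lam (D.Lam (D.Δ (D.S (D.e p))) (D.Δ (D.e q)))), ← map_sw, c2]
  simp [Lam_one_left]

end Cal
end Part3

section Part4
set_option linter.unusedSimpArgs false
namespace Cal
variable {k ι H : Type*} [Field k] [Ring H] [Algebra k H] (D : Cal k ι H)
variable {M N : Type*} [AddCommGroup M] [Module k M] [AddCommGroup N] [Module k N]

noncomputable def Rm (k : Type*) {H : Type*} [Field k] [Ring H] [Algebra k H] :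
    H →ₗ[k] H ⊗[k] H →ₗ[k] H ⊗[k] H :=
  (LinearMap.lTensorHom H) ∘ₗ (LinearMap.mul k H).flip

@[simp] theorem Rm_tmul (s u v : H) : Rm k s (u ⊗ₜ[k] v) = u ⊗ₜ[k] (v * s) := by
  simp [Rm]

theorem Rm_mul (s t : H) (p : H ⊗[k] H) : Rm k t (Rm k s p) = Rm k (s * t) p := by
  have : Rm k t ∘ₗ Rm k s = Rm k (s * t) := by
    ext u v; simp [mul_assoc]
  exact LinearMap.congr_fun this p

theorem Lam_Rm (p : H ⊗[k] H) (s : H) (q : H ⊗[k] H) :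
    D.Lam p (Rm k s q) = Rm k s (D.Lam p q) := by
  have h1 : ∀ i j, D.Lam (D.e i ⊗ₜ D.e j) ∘ₗ Rm k s = Rm k s ∘ₗ D.Lam (D.e i ⊗ₜ D.e j) := by
    intro i j
    apply D.ten_ext; intro l m
    simp [Lam_ee, mul_assoc]
  have : LinearMap.applyₗ (Rm k s q) ∘ₗ D.Lam = Rm k s ∘ₗ LinearMap.applyₗ q ∘ₗ D.Lam := by
    apply D.ten_ext; intro i j
    exact LinearMap.congr_fun (h1 i j) q
  exact LinearMap.congr_fun this p

theorem sw_app (F : ι → ι → (M →ₗ[k] N)) (x : H) (z : M) :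
    (D.sw F x) z = D.sw (fun i j => F i j z) x :=
  D.map_sw (LinearMap.applyₗ z) F x

theorem E1 (x y : H) : D.sw (fun a l => Rm k (D.S (D.e l)) (D.Δ (x * D.e a))) y =
    D.sw (fun i j => (D.e i * D.χ j y) ⊗ₜ[k] D.e j) x := by
  simp only [comul_mul, map_sw, Rm_tmul]
  have h : ∀ a l : ι, D.sw (fun i j => D.sw (fun p q =>
      (D.e i * D.χ j (D.e p)) ⊗ₜ[k] (D.e j * D.e q * D.S (D.e l))) (D.e a)) x =
      D.sw (fun p q => D.sw (fun i j =>
      (D.e i * D.χ j (D.e p)) ⊗ₜ[k] (D.e j * D.e q * D.S (D.e l))) x) (D.e a) := by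
    intro a l; rw [sw_swap]
  rw [sw_swap]
  apply sw_congr; intro i j
  rw [D.coassoc (fun p q l => (D.e i * D.χ j (D.e p)) ⊗ₜ[k] (D.e j * D.e q * D.S (D.e l)))]
  simp only [mul_assoc, ← tmul_sw, ← mul_sw, antipode_r]
  have h2 := D.counit_rl (((TensorProduct.mk k H H).flip (D.e j)) ∘ₗ (LinearMap.mulLeft k (D.e i))
    ∘ₗ (D.χ j).toLinearMap) y
  simp only [LinearMap.comp_apply, LinearMap.flip_apply, TensorProduct.mk_apply,
    LinearMap.mulLeft_apply, AlgHom.toLinearMap_apply] at h2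
  rw [← h2]
  apply sw_congr; intro p q
  simp

noncomputable def PP : H ⊗[k] H →ₗ[k] (H ⊗[k] H) ⊗[k] H :=
  (TensorProduct.assoc k H H H).symm.toLinearMap ∘ₗ (LinearMap.lTensor H D.Δ)

theorem PP_tmul (u v : H) : D.PP (u ⊗ₜ v) = D.sw (fun p q => (u ⊗ₜ[k] D.e p) ⊗ₜ[k] D.e q) v := by
  unfold PP
  simp only [LinearMap.comp_apply, LinearMap.lTensor_tmul]
  rw [D.Δ_sw, tmul_sw, map_sw]
  simp

theorem PP_R (w : H) (l : ι) : D.PP (Rm k (D.S (D.e l)) (D.Δ w)) =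
    D.sw (fun r s => D.sw (fun i j => Rm k (D.S (D.e r)) (D.Δ (D.e i)) ⊗ₜ[k]
      (D.ψ r (D.e j) * D.S (D.e s))) w) (D.e l) := by
  rw [D.Δ_sw w]
  simp only [map_sw, Rm_tmul]
  have h1 : ∀ i j, D.PP (D.e i ⊗ₜ (D.e j * D.S (D.e l))) =
     D.sw (fun p q => D.sw (fun r s =>
      ((D.e i) ⊗ₜ[k] (D.e p * D.χ q (D.S (D.e r)))) ⊗ₜ[k] (D.e q * D.S (D.e s))) (D.e l)) (D.e j) := by
    intro i j
    unfold PP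
    simp only [LinearMap.comp_apply, LinearMap.lTensor_tmul]
    rw [Δ_mul, Δ_S, D.Δ_sw (D.e j), D.Δ_sw (D.e l)]
    simp only [map_sw, sw_app, TensorProduct.map_tmul, Lam_ee, tmul_sw]
    simp only [LinearEquiv.coe_coe, TensorProduct.assoc_symm_tmul]
    rw [sw_swap]
  simp only [h1]
  rw [← D.coassoc (fun i p q => D.sw (fun r s =>
      ((D.e i) ⊗ₜ[k] (D.e p * D.χ q (D.S (D.e r)))) ⊗ₜ[k] (D.e q * D.S (D.e s))) (D.e l))]
  rw [sw_swap]
  apply sw_congr; intro i j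
  rw [sw_swap]
  apply sw_congr; intro r s
  rw [D.Δ_sw (D.e i)]
  simp only [map_sw, Rm_tmul, sw_tmul]
  apply sw_congr; intro p q
  rw [← D.S_χ, D.χ_e, D.ψ_e]
  simp [smul_tmul]

theorem E3 (x y : H) :
    D.sw (fun i j => D.sw (fun p q => ((D.e i * D.χ j y) ⊗ₜ[k] D.e p) ⊗ₜ[k] D.e q) (D.e j)) x =
    D.sw (fun i j => D.sw (fun a l => Rm k (D.S (D.χ j (D.e l))) (D.Δ (D.e i * D.χ j (D.e a)))
      ⊗ₜ[k] D.e j) y) x := by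
  have h1 := congrArg D.PP (D.E1 x y)
  simp only [map_sw, PP_tmul] at h1
  rw [← h1]
  simp only [PP_R]
  have h2 : ∀ a r s, D.sw (fun i j => Rm k (D.S (D.e r)) (D.Δ (D.e i)) ⊗ₜ[k]
      (D.ψ r (D.e j) * D.S (D.e s))) (x * D.e a) = D.sw (fun i j => D.sw (fun p q =>
      Rm k (D.S (D.e r)) (D.Δ (D.e i * D.χ j (D.e p))) ⊗ₜ[k]
      (D.ψ r (D.e j * D.e q) * D.S (D.e s))) (D.e a)) x := by
    intro a r s
    have := D.sw_ab ((TensorProduct.mk k (H ⊗[k] H) H).compl₁₂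
      (Rm k (D.S (D.e r)) ∘ₗ D.Δ) (LinearMap.mulRight k (D.S (D.e s)) ∘ₗ (D.ψ r).toLinearMap))
        x (D.e a)
    simpa using this
  simp only [h2]
  have h3 : ∀ a l, D.sw (fun r s => D.sw (fun i j => D.sw (fun p q =>
      Rm k (D.S (D.e r)) (D.Δ (D.e i * D.χ j (D.e p))) ⊗ₜ[k]
      (D.ψ r (D.e j * D.e q) * D.S (D.e s))) (D.e a)) x) (D.e l) =
      D.sw (fun i j => D.sw (fun p q => D.sw (fun r s =>
      Rm k (D.S (D.e r)) (D.Δ (D.e i * D.χ j (D.e p))) ⊗ₜ[k]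
      (D.ψ r (D.e j * D.e q) * D.S (D.e s))) (D.e l)) (D.e a)) x := by
    intro a l
    rw [sw_swap]
    apply sw_congr; intro i j
    rw [sw_swap]
  simp only [h3]
  rw [sw_swap]
  apply sw_congr; intro i j
  rw [mid_swap]
  have h4 := D.counit_rl (D.sw (fun a l => Rm k (D.S (D.χ j (D.e l))) (D.Δ (D.e i * D.χ j (D.e a)))
      ⊗ₜ[k] D.e j)) y
  rw [← h4]
  apply sw_congr; intro a l
  rw [smul_sw]
  apply sw_congr; intro p q
  have h5 : ∀ r s, D.φ q r • (Rm k (D.S (D.e q)) (D.Δ (D.e i * D.χ j (D.e p))) ⊗ₜ[k]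
      (D.ψ q (D.e j * D.e r) * D.S (D.e s))) = Rm k (D.S (D.χ j (D.e q)))
        (D.Δ (D.e i * D.χ j (D.e p))) ⊗ₜ[k] (D.e j * (D.e r * D.S (D.e s))) := by
    intro r s
    simp only [map_mul, D.ψ_e, D.χ_e, map_smul, LinearMap.smul_apply, smul_mul_assoc,
      mul_smul_comm, smul_smul, tmul_smul, ← smul_tmul', mul_assoc]
    congr 1
    rw [mul_comm (D.φ j q), mul_comm (D.φ j p), ← mul_assoc (D.φ r q),
      ← mul_assoc (D.φ q r)]
    have := D.skew q r
    linear_combination (D.φ j q * D.φ j p) * this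
  simp only [h5, ← tmul_sw, ← mul_sw, antipode_r]
  simp

noncomputable def Bq (q : ι) : H →ₗ[k] H ⊗[k] H :=
  D.sw (fun a l => Rm k (D.S (D.χ q (D.e l))) (D.Δ (D.χ q (D.e a))))

noncomputable def Ah (h : ι) : H →ₗ[k] H ⊗[k] H :=
  D.sw (fun i j => D.sw (fun p q => (D.φ i h * D.φ j h) • ((D.S (D.e i) * D.e p) ⊗ₜ[k] D.e q)) (D.e j))

theorem club (q h : ι) : D.Bq q (D.e h) ⊗ₜ[k] D.e q =
    (TensorProduct.assoc k H H H).symm (D.e h ⊗ₜ[k] D.Ah h (D.e q)) := by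
  -- apply `Δ(S x0)` on the first two slots
  let Z : ι → (H ⊗[k] H) ⊗[k] H →ₗ[k] (H ⊗[k] H) ⊗[k] H := fun a =>
    LinearMap.rTensor H (D.Lam (D.Δ (D.S (D.e a))))
  have hE := fun b => D.E3 (D.e b) (D.e h)
  have hZ : D.sw (fun a b => Z a (D.sw (fun i j => D.sw (fun p q =>
      ((D.e i * D.χ j (D.e h)) ⊗ₜ[k] D.e p) ⊗ₜ[k] D.e q) (D.e j)) (D.e b))) (D.e q) =
      D.sw (fun a b => Z a (D.sw (fun i j => D.sw (fun a l => Rm k (D.S (D.χ j (D.e l)))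
        (D.Δ (D.e i * D.χ j (D.e a))) ⊗ₜ[k] D.e j) (D.e h)) (D.e b))) (D.e q) := by
    simp only [hE]
  have hR : D.sw (fun a b => Z a (D.sw (fun i j => D.sw (fun a l => Rm k (D.S (D.χ j (D.e l)))
        (D.Δ (D.e i * D.χ j (D.e a))) ⊗ₜ[k] D.e j) (D.e h)) (D.e b))) (D.e q) =
        D.Bq q (D.e h) ⊗ₜ[k] D.e q := by
    simp only [map_sw, Z, LinearMap.rTensor_tmul, Lam_Rm, ← Δ_mul]
    rw [← D.coassoc (fun a i j => D.sw (fun c l => Rm k (D.S (D.χ j (D.e l)))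
        (D.Δ (D.S (D.e a) * (D.e i * D.χ j (D.e c)))) ⊗ₜ[k] D.e j) (D.e h))]
    rw [← D.counit_le (fun q => D.Bq q (D.e h) ⊗ₜ[k] D.e q)]
    apply sw_congr; intro i j
    rw [sw_swap]
    unfold Bq
    rw [sw_tmul, smul_sw]
    apply sw_congr; intro c l
    simp only [← sw_tmul, ← map_sw, ← mul_assoc, ← sw_mul, antipode_l]
    simp [smul_tmul']
  have hL : D.sw (fun a b => Z a (D.sw (fun i j => D.sw (fun p q =>
      ((D.e i * D.χ j (D.e h)) ⊗ₜ[k] D.e p) ⊗ₜ[k] D.e q) (D.e j)) (D.e b))) (D.e q) =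
      (TensorProduct.assoc k H H H).symm (D.e h ⊗ₜ[k] D.Ah h (D.e q)) := by
    have h1 : ∀ a b, Z a (D.sw (fun i j => D.sw (fun p q =>
      ((D.e i * D.χ j (D.e h)) ⊗ₜ[k] D.e p) ⊗ₜ[k] D.e q) (D.e j)) (D.e b)) =
      D.sw (fun c d => D.sw (fun i j => D.sw (fun p q => (D.φ d i * D.φ d h * D.φ j h) •
      ((D.S (D.e c) * D.e i * D.e h) ⊗ₜ[k] (D.S (D.e d) * D.e p)) ⊗ₜ[k] D.e q) (D.e j))
        (D.e b)) (D.e a) := by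
      intro a b
      simp only [map_sw, Z, LinearMap.rTensor_tmul]
      rw [Δ_S, D.Δ_sw (D.e a)]
      simp only [map_sw, sw_app, TensorProduct.map_tmul, Lam_S, sw_tmul]
      rw [sw_swap]
      apply sw_congr; intro i j
      rw [sw_swap]
      simp only [D.χ_e, map_smul, map_mul, mul_smul_comm, smul_mul_assoc, smul_smul, ← smul_tmul']
      apply sw_congr; intro c d
      apply sw_congr; intro p q
      rw [mul_assoc (D.S (D.e c))]
      congr 1; ring
    simp only [h1]
    rw [mid_swap]
    have h2 : ∀ c d i j, D.φ d i • D.sw (fun p q => (D.φ i d * D.φ i h * D.φ j h) •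
      ((D.S (D.e c) * D.e d * D.e h) ⊗ₜ[k] (D.S (D.e i) * D.e p)) ⊗ₜ[k] D.e q) (D.e j) =
      D.sw (fun p q => (D.φ i h * D.φ j h) •
      ((D.S (D.e c) * D.e d * D.e h) ⊗ₜ[k] (D.S (D.e i) * D.e p)) ⊗ₜ[k] D.e q) (D.e j) := by
      intro c d i j
      rw [smul_sw]
      apply sw_congr; intro p q
      rw [smul_smul]
      congr 1
      linear_combination (D.φ i h * D.φ j h) * D.skew d i
    simp only [h2]
    have h3 : (TensorProduct.assoc k H H H).symm (D.e h ⊗ₜ[k] D.Ah h (D.e q)) =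
       D.sw (fun i j => D.sw (fun p q => (D.φ i h * D.φ j h) •
        ((D.e h ⊗ₜ[k] (D.S (D.e i) * D.e p)) ⊗ₜ[k] D.e q)) (D.e j)) (D.e q) := by
      unfold Ah
      refine (D.map_sw ((TensorProduct.assoc k H H H).symm.toLinearMap ∘ₗ
        TensorProduct.mk k H (H ⊗[k] H) (D.e h)) _ _).trans ?_
      apply sw_congr; intro i j
      refine (D.map_sw ((TensorProduct.assoc k H H H).symm.toLinearMap ∘ₗ
        TensorProduct.mk k H (H ⊗[k] H) (D.e h)) _ _).trans ?_
      apply sw_congr; intro p q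
      simp
    rw [h3, ← D.counit_ll (D.sw (fun i j => D.sw (fun p q => (D.φ i h * D.φ j h) •
        ((D.e h ⊗ₜ[k] (D.S (D.e i) * D.e p)) ⊗ₜ[k] D.e q)) (D.e j))) (D.e q)]
    apply sw_congr; intro a b
    rw [sw_swap, smul_sw]
    apply sw_congr; intro i j
    rw [sw_swap, smul_sw]
    apply sw_congr; intro p q
    simp only [← smul_sw, ← sw_tmul, ← sw_mul, antipode_l]
    simp [smul_tmul', smul_smul, mul_comm, mul_left_comm]
  rw [← hR, ← hZ, hL]

end Cal
end Part4

section Part5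
set_option linter.unusedSimpArgs false
namespace Cal
variable {k ι H : Type*} [Field k] [Ring H] [Algebra k H] (D : Cal k ι H)
variable {M N : Type*} [AddCommGroup M] [Module k M] [AddCommGroup N] [Module k N]

theorem e_coord (q : ι) : D.e.coord q (D.e q) = 1 := by simp

theorem e_tmul_inj (h : ι) {u v : M} (huv : D.e h ⊗ₜ[k] u = D.e h ⊗ₜ[k] v) : u = v := by
  have := congrArg ((TensorProduct.lid k M).toLinearMap ∘ₗ LinearMap.rTensor M (D.e.coord h)) huv
  simpa using this

noncomputable def TT (q h : ι) : H :=
  TensorProduct.rid k H (LinearMap.lTensor H (D.e.coord q) (D.Ah h (D.e q)))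

theorem B_eq (q h : ι) : D.Bq q (D.e h) = D.e h ⊗ₜ[k] D.TT q h := by
  have h1 := congrArg ((TensorProduct.rid k (H ⊗[k] H)).toLinearMap ∘ₗ
    LinearMap.lTensor (H ⊗[k] H) (D.e.coord q)) (D.club q h)
  have h2 : ∀ A : H ⊗[k] H, ((TensorProduct.rid k (H ⊗[k] H)).toLinearMap ∘ₗ
    LinearMap.lTensor (H ⊗[k] H) (D.e.coord q))
    ((TensorProduct.assoc k H H H).symm (D.e h ⊗ₜ[k] A)) = D.e h ⊗ₜ[k]
      TensorProduct.rid k H (LinearMap.lTensor H (D.e.coord q) A) := by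
    intro A
    induction A with
    | zero => simp
    | tmul x y => simp
    | add x y hx hy => simp only [tmul_add, map_add, hx, hy]
  rw [h2] at h1
  simpa [TT] using h1

theorem A_eq (q h : ι) : D.Ah h (D.e q) = D.TT q h ⊗ₜ[k] D.e q := by
  have h1 := congrArg (TensorProduct.assoc k H H H) (D.club q h)
  rw [B_eq] at h1
  simp only [TensorProduct.assoc_tmul, LinearEquiv.apply_symm_apply] at h1
  exact (D.e_tmul_inj h h1).symm

theorem φ_ε (j h : ι) : D.φ j h * D.ε (D.e j) = D.ε (D.e j) := by
  have := D.ε_ψ h (D.e j)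
  rwa [D.ψ_e, map_smul, smul_eq_mul] at this

theorem C1 (q h : ι) : D.TT q h * D.S (D.e q) = D.φ q h • D.S (D.e q) := by
  have h1 := congrArg (TensorProduct.lift ((LinearMap.mul k H).compl₂ D.S)) (D.A_eq q h)
  simp only [TensorProduct.lift.tmul, LinearMap.compl₂_apply, LinearMap.mul_apply'] at h1
  rw [← h1]
  unfold Ah
  simp only [map_sw, map_smul, TensorProduct.lift.tmul, LinearMap.compl₂_apply,
    LinearMap.mul_apply', mul_assoc, ← smul_sw, ← mul_sw, antipode_r]
  rw [← D.counit_re (fun q => D.φ q h • D.S (D.e q))]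
  apply sw_congr; intro i j
  have h3 := D.φ_ε j h
  simp only [mul_smul_comm, mul_one, smul_smul]
  congr 1
  linear_combination D.φ i h * h3

theorem D1 (q : ι) (y : H) : D.Δ (D.χ q y) =
    D.sw (fun a l => D.e a ⊗ₜ[k] (D.TT q a * D.χ q (D.e l))) y := by
  have h1 : ∀ a l, D.e a ⊗ₜ[k] (D.TT q a * D.χ q (D.e l)) =
      D.sw (fun b c => Rm k (D.χ q (D.S (D.e c) * D.e l)) (D.Δ (D.χ q (D.e b)))) (D.e a) := by
    intro a l
    rw [← Rm_tmul, ← B_eq]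
    unfold Bq
    rw [map_sw]
    simp only [Rm_mul, D.S_χ, map_mul]
  simp only [h1]
  rw [D.coassoc (fun b c l => Rm k (D.χ q (D.S (D.e c) * D.e l)) (D.Δ (D.χ q (D.e b))))]
  have h2 : ∀ b j, D.sw (fun c l => Rm k (D.χ q (D.S (D.e c) * D.e l)) (D.Δ (D.χ q (D.e b))))
      (D.e j) = D.ε (D.e j) • D.Δ (D.χ q (D.e b)) := by
    intro b j
    have h3 := D.map_sw (LinearMap.applyₗ (D.Δ (D.χ q (D.e b))) ∘ₗ Rm k ∘ₗ (D.χ q).toLinearMap)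
      (fun c l => D.S (D.e c) * D.e l) (D.e j)
    rw [antipode_l] at h3
    refine h3.symm.trans ?_
    simp only [map_smul, LinearMap.comp_apply, AlgHom.toLinearMap_apply, map_one]
    have h4 : ∀ p : H ⊗[k] H, Rm k 1 p = p := by
      intro p
      have : Rm k (1 : H) = LinearMap.id := by ext; simp
      rw [this]; rfl
    simp [h4]
  simp only [h2]
  exact (D.counit_rl (D.Δ ∘ₗ (D.χ q).toLinearMap) y).symm

theorem D2 (h : ι) (x : H) : D.Δ (D.ψ h x) =
    D.sw (fun i j => (D.ψ h (D.e i) * D.TT j h) ⊗ₜ[k] D.e j) x := by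
  let Lm : H → H ⊗[k] H →ₗ[k] H ⊗[k] H := fun u => LinearMap.rTensor H (LinearMap.mulLeft k u)
  have h1 : ∀ i j, (D.ψ h (D.e i) * D.TT j h) ⊗ₜ[k] D.e j =
      D.sw (fun p q => D.sw (fun r s => (D.φ p h * D.φ q h) •
        ((D.ψ h (D.e i) * D.S (D.e p) * D.e r) ⊗ₜ[k] D.e s)) (D.e q)) (D.e j) := by
    intro i j
    have : (D.ψ h (D.e i) * D.TT j h) ⊗ₜ[k] D.e j = Lm (D.ψ h (D.e i)) (D.TT j h ⊗ₜ[k] D.e j) := by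
      simp [Lm]
    rw [this, ← A_eq]
    unfold Ah
    simp only [map_sw, map_smul, Lm, LinearMap.rTensor_tmul, LinearMap.mulLeft_apply, mul_assoc]
  simp only [h1]
  rw [← D.coassoc (fun i p q => D.sw (fun r s => (D.φ p h * D.φ q h) •
        ((D.ψ h (D.e i) * D.S (D.e p) * D.e r) ⊗ₜ[k] D.e s)) (D.e q))]
  refine (D.counit_ll (D.Δ ∘ₗ (D.ψ h).toLinearMap) x).symm.trans ?_
  apply sw_congr; intro i j
  rw [sw_swap]
  simp only [LinearMap.comp_apply, AlgHom.toLinearMap_apply, D.ψ_e, map_smul]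
  rw [D.Δ_sw (D.e j), smul_sw, smul_sw]
  apply sw_congr; intro r s
  have h3 := D.ψ_sw h (fun i p => D.e i * D.S (D.e p)) (D.e i)
  rw [antipode_r, map_smul, map_one] at h3
  have h4 : D.ε (D.e i) • D.φ j h • (D.e r ⊗ₜ[k] D.e s) =
     (D.φ j h) • ((D.ε (D.e i) • (1 : H)) * D.e r) ⊗ₜ[k] D.e s := by
    simp [smul_smul, ← smul_tmul', mul_comm]
  rw [h4, h3, sw_mul, sw_tmul, smul_sw]
  apply sw_congr; intro a b
  simp only [map_mul, ← D.S_ψ, D.ψ_e, map_smul, smul_mul_assoc, mul_smul_comm, smul_smul,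
    ← smul_tmul']
  congr 1; ring

noncomputable def tau (b : ι) : H ⊗[k] H →ₗ[k] H ⊗[k] H :=
  D.bil (fun a l => D.e a ⊗ₜ[k] (D.TT b a * D.χ b (D.e l)))

theorem tau_e (b a : ι) (v : H) : D.tau b (D.e a ⊗ₜ v) = D.e a ⊗ₜ[k] (D.TT b a * D.χ b v) := by
  have : D.tau b ∘ₗ TensorProduct.mk k H H (D.e a) = TensorProduct.mk k H H (D.e a) ∘ₗ
      LinearMap.mulLeft k (D.TT b a) ∘ₗ (D.χ b).toLinearMap := by
    apply D.e.ext; intro l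
    simp [tau]
  exact LinearMap.congr_fun this v

theorem tau_Δ (b : ι) (y : H) : D.Δ (D.χ b y) = D.tau b (D.Δ y) := by
  rw [D1, D.Δ_sw y, map_sw]; simp only [tau_e]

theorem tau_Rm (b : ι) (s : H) (p : H ⊗[k] H) :
    D.tau b (Rm k s p) = Rm k (D.χ b s) (D.tau b p) := by
  have : D.tau b ∘ₗ Rm k s = Rm k (D.χ b s) ∘ₗ D.tau b := by
    apply D.ten_ext; intro i j
    simp [tau_e, mul_assoc]
  exact LinearMap.congr_fun this p

theorem N00 (b h : ι) (c : ι) :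
    D.TT b h * (D.S (D.e c) * D.S (D.e b)) = D.φ b h • (D.S (D.e c) * D.S (D.e b)) := by
  -- the linear map K
  let K : H →ₗ[k] H ⊗[k] H :=
    D.sw (fun a m => (LinearMap.applyₗ (D.Δ (D.e a))) ∘ₗ Rm k ∘ₗ LinearMap.mulLeft k (D.S (D.e m)) ∘ₗ
      D.S ∘ₗ (D.ψ a).toLinearMap ∘ₗ (D.ψ m).toLinearMap) (D.e h)
  have hK : ∀ z, K z = D.sw (fun a m => Rm k (D.S (D.e m) * D.S (D.ψ a (D.ψ m z)))
      (D.Δ (D.e a))) (D.e h) := by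
    intro z
    simp only [K, sw_app]; rfl
  have hK2 : ∀ z, K z = D.e h ⊗ₜ D.S (D.ψ h z) := by
    intro z
    have : K = TensorProduct.mk k H H (D.e h) ∘ₗ D.S ∘ₗ (D.ψ h).toLinearMap := by
      apply D.e.ext; intro l
      have h1 : K (D.e l) = Rm k (D.S (D.e l)) (D.Bq l (D.e h)) := by
        rw [hK]; unfold Bq; rw [map_sw]
        apply sw_congr; intro a m
        rw [Rm_mul]
        simp only [D.ψ_e, D.χ_e, map_smul, smul_mul_assoc, mul_smul_comm, LinearMap.smul_apply,
          smul_smul]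
        congr 1; ring
      rw [h1, B_eq, Rm_tmul, C1]
      simp [D.ψ_e]
    rw [this]; rfl
  have h3 : K (D.e b * D.e c) = Rm k (D.S (D.e b * D.e c)) (D.tau b (D.Bq c (D.e h))) := by
    rw [hK]; unfold Bq; rw [map_sw, map_sw]
    apply sw_congr; intro a m
    rw [tau_Rm, ← tau_Δ, Rm_mul, ← D.S_χ]
    simp only [D.ψ_e, D.χ_e, map_smul, map_mul, smul_mul_assoc, mul_smul_comm,
      LinearMap.smul_apply, smul_smul]
    congr 1; ring
  rw [hK2, B_eq, tau_e, Rm_tmul] at h3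
  have h4 := D.e_tmul_inj h h3
  have h5 := congrArg (D.χ b) (D.C1 c h)
  simp only [map_mul, map_smul, ← D.S_χ, D.χ_e, mul_smul_comm] at h5
  simp only [map_mul, D.ψ_e, S_anti_e, map_smul, smul_mul_assoc, mul_smul_comm, smul_smul] at h4
  rw [mul_assoc (D.TT b h), ← mul_assoc (D.χ b (D.TT c h))] at h4
  have h6 : D.χ b (D.TT c h) * D.S (D.e c) = D.φ c h • D.S (D.e c) := by
    rw [smul_comm] at h5
    exact smul_right_injective H (D.φne b c) h5
  rw [h6] at h4
  simp only [smul_mul_assoc, mul_smul_comm, smul_smul] at h4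
  have h7 : (D.φ b c * D.φ c h) • (D.TT b h * (D.S (D.e c) * D.S (D.e b))) =
      (D.φ b c * D.φ c h) • D.φ b h • (D.S (D.e c) * D.S (D.e b)) := by
    rw [← h4, smul_smul]
    congr 1; ring
  exact smul_right_injective H (mul_ne_zero (D.φne b c) (D.φne c h)) h7

theorem N0 (b h : ι) (w : H) :
    D.TT b h * (w * D.S (D.e b)) = D.φ b h • (w * D.S (D.e b)) := by
  have : LinearMap.mulLeft k (D.TT b h) ∘ₗ LinearMap.mulRight k (D.S (D.e b)) ∘ₗ D.S =
      D.φ b h • (LinearMap.mulRight k (D.S (D.e b)) ∘ₗ D.S) := by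
    apply D.e.ext; intro c
    simpa using D.N00 b h c
  have h := LinearMap.congr_fun this (D.S w)
  simpa [SS] using h

/-- adjoint action -/
noncomputable def ad : H →ₗ[k] H →ₗ[k] H :=
  D.sw (fun i j => LinearMap.mulRight k (D.S (D.e j)) ∘ₗ LinearMap.mulLeft k (D.e i) ∘ₗ
    (D.χ j).toLinearMap)

theorem ad_apply (a x : H) : D.ad a x = D.sw (fun i j => D.e i * D.χ j x * D.S (D.e j)) a := by
  unfold ad; rw [sw_app]; rfl

theorem ψ_ad0 (h : ι) (x w : H) : D.ad (D.ψ h x) w =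
    D.sw (fun i j => D.ψ h (D.e i) * D.χ j w * D.S (D.ψ h (D.e j))) x := by
  rw [ad_apply, sw_bil, D2, map_sw]
  apply sw_congr; intro i j
  have h1 : ∀ u, D.bil (fun i j => D.e i * D.χ j w * D.S (D.e j)) (u ⊗ₜ D.e j) =
      u * D.χ j w * D.S (D.e j) := by
    intro u
    have : D.bil (fun i j => D.e i * D.χ j w * D.S (D.e j)) ∘ₗ
       (TensorProduct.mk k H H).flip (D.e j) = LinearMap.mulRight k (D.χ j w * D.S (D.e j)) := by
      apply D.e.ext; intro i
      simp [mul_assoc]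
    simpa [mul_assoc] using LinearMap.congr_fun this u
  rw [h1, mul_assoc, mul_assoc, N0]; simp [D.ψ_e, mul_assoc]

end Cal
end Part5

section Part6
set_option linter.unusedSimpArgs false
namespace Cal
variable {k ι H : Type*} [Field k] [Ring H] [Algebra k H] (D : Cal k ι H)
variable {M N : Type*} [AddCommGroup M] [Module k M] [AddCommGroup N] [Module k N]

/-- diagonal automorphisms compatible with the adjoint action -/
structure Good (θ : H →ₐ[k] H) : Prop where
  diag : ∃ t : ι → k, ∀ i, θ (D.e i) = t i • D.e i
  surj : Function.Surjective θ
  S : ∀ x, D.S (θ x) = θ (D.S x)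
  ad : ∀ x w, θ (D.ad x w) = D.ad (θ x) (θ w)

variable {D}

theorem Good.χ_comm {θ : H →ₐ[k] H} (hθ : D.Good θ) (j : ι) (x : H) :
    θ (D.χ j x) = D.χ j (θ x) := by
  obtain ⟨t, ht⟩ := hθ.diag
  have : θ.toLinearMap ∘ₗ (D.χ j).toLinearMap = (D.χ j).toLinearMap ∘ₗ θ.toLinearMap := by
    apply D.e.ext; intro i
    simp [D.χ_e, ht, smul_smul, mul_comm]
  exact LinearMap.congr_fun this x

theorem Good.ψ_comm {θ : H →ₐ[k] H} (hθ : D.Good θ) (j : ι) (x : H) :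
    θ (D.ψ j x) = D.ψ j (θ x) := by
  obtain ⟨t, ht⟩ := hθ.diag
  have : θ.toLinearMap ∘ₗ (D.ψ j).toLinearMap = (D.ψ j).toLinearMap ∘ₗ θ.toLinearMap := by
    apply D.e.ext; intro i
    simp [D.ψ_e, ht, smul_smul, mul_comm]
  exact LinearMap.congr_fun this x

theorem Good.comp {θ η : H →ₐ[k] H} (hθ : D.Good θ) (hη : D.Good η) : D.Good (θ.comp η) where
  diag := by
    obtain ⟨t, ht⟩ := hθ.diag
    obtain ⟨s, hs⟩ := hη.diag
    exact ⟨fun i => s i * t i, fun i => by simp [hs, ht, smul_smul]⟩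
  surj := hθ.surj.comp hη.surj
  S x := by simp [hθ.S, hη.S]
  ad x w := by simp [hθ.ad, hη.ad]

theorem good_id : D.Good (AlgHom.id k H) where
  diag := ⟨fun _ => 1, fun i => by simp⟩
  surj := Function.surjective_id
  S x := rfl
  ad x w := rfl

theorem Good.map_sw {θ : H →ₐ[k] H} (_ : D.Good θ) (F : ι → ι → H) (a : H) :
    θ (D.sw F a) = D.sw (fun i j => θ (F i j)) a := D.map_sw θ.toLinearMap F a

theorem ψχ_comm (h j : ι) (x : H) : D.ψ h (D.χ j x) = D.χ j (D.ψ h x) := by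
  have : (D.ψ h).toLinearMap ∘ₗ (D.χ j).toLinearMap =
      (D.χ j).toLinearMap ∘ₗ (D.ψ h).toLinearMap := by
    apply D.e.ext; intro i
    simp [D.χ_e, D.ψ_e, smul_smul, mul_comm]
  exact LinearMap.congr_fun this x

theorem ψ_ad (h : ι) (x w : H) : D.ψ h (D.ad x w) = D.ad (D.ψ h x) (D.ψ h w) := by
  rw [ψ_ad0, ad_apply, ψ_sw]
  simp only [map_mul, ψχ_comm, S_ψ]

theorem good_ψ (h : ι) : D.Good (D.ψ h) where
  diag := ⟨_, D.ψ_e h⟩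
  surj x := ⟨_, D.ψχ h x⟩
  S x := D.S_ψ h x
  ad x w := ψ_ad h x w

theorem good_χ (h : ι) : D.Good (D.χ h) where
  diag := ⟨_, D.χ_e h⟩
  surj x := ⟨_, D.χψ h x⟩
  S x := D.S_χ h x
  ad x w := by
    have := ψ_ad (D := D) h (D.χ h x) (D.χ h w)
    rw [D.ψχ, D.ψχ] at this
    rw [← this, D.χψ]

theorem Good.ad0 {θ : H →ₐ[k] H} (hθ : D.Good θ) (x w : H) : D.ad (θ x) w =
    D.sw (fun i j => θ (D.e i) * D.χ j w * D.S (θ (D.e j))) x := by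
  obtain ⟨w, rfl⟩ := hθ.surj w
  rw [← hθ.ad, ad_apply, hθ.map_sw]
  simp only [map_mul, hθ.S, hθ.χ_comm]

variable (D)

theorem ad_e (a : H) (m : ι) : D.ad a (D.e m) =
    D.sw (fun i j => D.e i * D.e m * D.S (D.ψ m (D.e j))) a := by
  rw [ad_apply]
  apply sw_congr; intro i j
  simp [D.ψ_e, D.χ_e]

theorem L1 (a b x : H) : D.ad a (D.ad b x) = D.ad (a * b) x := by
  have : D.ad a ∘ₗ D.ad b = D.ad (a * b) := by
    apply D.e.ext; intro m
    rw [LinearMap.comp_apply]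
    conv_rhs => rw [ad_e]
    have h := D.sw_ab ((LinearMap.mul k H).compl₁₂ (LinearMap.mulRight k (D.e m))
      (D.S ∘ₗ (D.ψ m).toLinearMap)) a b
    simp only [LinearMap.compl₁₂_apply, LinearMap.mul_apply', LinearMap.mulRight_apply,
      LinearMap.comp_apply, AlgHom.toLinearMap_apply] at h
    rw [h, ad_apply, ad_e]
    apply sw_congr; intro i j
    rw [χ_sw, mul_sw, sw_mul]
    apply sw_congr; intro p q
    simp only [map_mul, D.ψ_e, D.χ_e, map_smul, smul_mul_assoc, mul_smul_comm, smul_smul,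
      mul_assoc, S_anti_e, ← D.S_χ]
    congr 1; ring
  exact LinearMap.congr_fun this x

theorem one_ad (x : H) : D.ad 1 x = x := by
  have : D.ad 1 = LinearMap.id := by
    apply D.e.ext; intro m
    rw [ad_e]
    have h := D.sw_one ((LinearMap.mul k H).compl₁₂ (LinearMap.mulRight k (D.e m))
      (D.S ∘ₗ (D.ψ m).toLinearMap))
    simp only [LinearMap.compl₁₂_apply, LinearMap.mul_apply', LinearMap.mulRight_apply,
      LinearMap.comp_apply, AlgHom.toLinearMap_apply] at h
    rw [h]; simp [S_one]
  rw [this]; rfl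

theorem ad_one (a : H) : D.ad a 1 = D.ε a • 1 := by
  rw [ad_apply, ← antipode_r]; simp

theorem L2 (a : H) (h : ι) : D.sw (fun i j => D.ad (D.e i) (D.e h) * D.ψ h (D.e j)) a =
    a * D.e h := by
  simp only [ad_e, sw_mul]
  rw [D.coassoc (fun p q j => D.e p * D.e h * D.S (D.ψ h (D.e q)) * D.ψ h (D.e j))]
  simp only [D.S_ψ, mul_assoc, ← map_mul]
  simp only [← mul_sw, ← ψ_sw, antipode_l]
  refine Eq.trans ?_ (D.counit_rl (LinearMap.mulRight k (D.e h)) a)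
  simp

theorem R1 (a z w : H) : D.ad a (z * w) =
    D.sw (fun i j => D.ad (D.e i) (D.χ j z) * D.ad (D.e j) w) a := by
  have : D.ad a ∘ₗ LinearMap.mulRight k w = D.sw (fun i j =>
      LinearMap.mulRight k (D.ad (D.e j) w) ∘ₗ D.ad (D.e i) ∘ₗ (D.χ j).toLinearMap) a := by
    apply D.e.ext; intro h
    rw [sw_app]
    simp only [LinearMap.comp_apply, LinearMap.mulRight_apply, AlgHom.toLinearMap_apply]
    have h1 : ∀ i j, D.ad (D.e i) (D.χ j (D.e h)) * D.ad (D.e j) w =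
        D.sw (fun p q => D.ad (D.e i) (D.e h) * D.ψ h (D.e p) * (D.χ q w * D.S (D.ψ h (D.e q))))
          (D.e j) := by
      intro i j
      have h2 := D.ψ_ad0 h (D.e j) w
      rw [D.ψ_e, map_smul, LinearMap.smul_apply] at h2
      rw [D.χ_e, map_smul, smul_mul_assoc, ← mul_smul_comm, h2, mul_sw]
      simp only [mul_assoc]
    simp only [h1]
    rw [← D.coassoc (fun i p q => D.ad (D.e i) (D.e h) * D.ψ h (D.e p) *
      (D.χ q w * D.S (D.ψ h (D.e q))))]
    simp only [← sw_mul, L2]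
    rw [ad_apply]
    apply sw_congr; intro i j
    simp only [map_mul, D.ψ_e, D.χ_e, map_smul, smul_mul_assoc, mul_smul_comm, mul_assoc]
  have h := LinearMap.congr_fun this z
  rw [sw_app] at h
  exact h

variable {D}

theorem Good.R {θ : H →ₐ[k] H} (hθ : D.Good θ) (a z w : H) : D.ad (θ a) (z * w) =
    D.sw (fun i j => D.ad (θ (D.e i)) (D.χ j z) * D.ad (θ (D.e j)) w) a := by
  obtain ⟨w, rfl⟩ := hθ.surj w
  obtain ⟨z, rfl⟩ := hθ.surj z
  rw [← map_mul, ← hθ.ad, R1, hθ.map_sw]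
  simp only [map_mul, hθ.ad, hθ.χ_comm]

variable (D)
noncomputable def J : H →ₗ[k] H →ₗ[k] H :=
  (LinearMap.flip (D.sw (fun a l => (LinearMap.mulRight k (D.S (D.e l))) ∘ₗ D.ad.flip (D.e a))))

theorem J_apply (X Y : H) : D.J X Y = D.sw (fun a l => D.ad X (D.e a) * D.S (D.e l)) Y := by
  unfold J; rw [LinearMap.flip_apply, sw_app]; rfl

variable {D}

theorem Good.J2 {θ : H →ₐ[k] H} (hθ : D.Good θ) (X Y : H) :
    D.sw (fun a l => D.ad X (θ (D.e a)) * D.S (θ (D.e l))) Y =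
    D.sw (fun i j => D.e i * D.ad (D.χ j (θ Y)) (D.S (D.e j))) X := by
  have h1 : ∀ i j, D.e i * D.ad (D.χ j (θ Y)) (D.S (D.e j)) =
      D.sw (fun a l => D.e i * D.χ j (θ (D.e a)) * D.S (D.e j) * D.S (θ (D.e l))) Y := by
    intro i j
    obtain ⟨t, ht⟩ := hθ.diag
    have := ((good_χ (D := D) j).comp hθ).ad0 Y (D.S (D.e j))
    simp only [AlgHom.comp_apply] at this
    rw [this, mul_sw]
    apply sw_congr; intro a l
    rw [← D.S_χ]
    simp only [D.χ_e, ht, map_smul, smul_mul_assoc, mul_smul_comm, smul_smul, mul_assoc]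
    congr 1
    linear_combination (t l * t a * D.φ j a) * D.skew l j
  simp only [h1]
  rw [sw_swap]
  simp only [ad_apply, sw_mul]

theorem J_eq (X Y : H) : D.J X Y =
    D.sw (fun i j => D.e i * D.ad (D.χ j Y) (D.S (D.e j))) X := by
  rw [J_apply]
  exact good_id.J2 X Y

theorem Good.J {θ : H →ₐ[k] H} (hθ : D.Good θ) (X Y : H) :
    θ (D.J X Y) = D.J (θ X) (θ Y) := by
  rw [J_eq (θ X), ← hθ.J2, J_apply, hθ.map_sw]
  simp only [map_mul, hθ.ad, hθ.S]

theorem Good.klem {θ : H →ₐ[k] H} (hθ : D.Good θ) (a : H) (n : ι) (w : H) :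
    D.sw (fun i j => D.ad (θ (D.e i)) (D.ad (D.S (θ (D.e j))) (D.S (D.e n)) * w)) a =
    D.S (D.e n) * D.ad (θ (D.ψ n a)) w := by
  obtain ⟨t, ht⟩ := hθ.diag
  have h1 : ∀ i j, D.ad (θ (D.e i)) (D.ad (D.S (θ (D.e j))) (D.S (D.e n)) * w) =
      D.sw (fun p q => (D.φ q j * D.φ q n) • (D.ad (θ (D.e p * D.S (D.e j))) (D.S (D.e n)) *
        D.ad (θ (D.e q)) w)) (D.e i) := by
    intro i j
    rw [hθ.R]
    apply sw_congr; intro p q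
    rw [(good_χ q).ad, ← D.S_χ, ← D.S_χ, ← hθ.χ_comm, D.χ_e, D.χ_e, map_mul, ← hθ.S, ← L1]
    simp only [map_smul, LinearMap.smul_apply, smul_mul_assoc, mul_smul_comm, smul_smul]
    congr 1; ring
  simp only [h1]
  rw [D.coassoc (fun p q j => (D.φ q j * D.φ q n) • (D.ad (θ (D.e p * D.S (D.e j))) (D.S (D.e n)) *
        D.ad (θ (D.e q)) w))]
  have h2 : ∀ i j, D.sw (fun q j => (D.φ q j * D.φ q n) • (D.ad (θ (D.e i * D.S (D.e j)))
        (D.S (D.e n)) * D.ad (θ (D.e q)) w)) (D.e j) =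
      D.sw (fun q j => (D.φ j n) • (D.ad (θ (D.e i * D.S (D.e q)))
        (D.S (D.e n)) * D.ad (θ (D.e j)) w)) (D.e j) := by
    intro i j
    rw [cocomm]
    apply sw_congr; intro q j
    rw [smul_smul]
    congr 1
    linear_combination D.φ j n * D.skew q j
  simp only [h2]
  rw [← D.coassoc (fun p q j => (D.φ j n) • (D.ad (θ (D.e p * D.S (D.e q)))
        (D.S (D.e n)) * D.ad (θ (D.e j)) w))]
  refine Eq.trans ?_ (D.counit_ll (LinearMap.mulLeft k (D.S (D.e n)) ∘ₗ D.ad.flip w ∘ₗ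
    θ.toLinearMap ∘ₗ (D.ψ n).toLinearMap) a)
  apply sw_congr; intro i j
  rw [← smul_sw, ← sw_mul]
  have h3 := D.map_sw (D.ad.flip (D.S (D.e n)) ∘ₗ θ.toLinearMap) (fun p q => D.e p * D.S (D.e q))
    (D.e i)
  rw [antipode_r] at h3
  simp only [LinearMap.comp_apply, AlgHom.toLinearMap_apply, LinearMap.flip_apply, map_smul,
    map_one, LinearMap.smul_apply, one_ad] at h3
  rw [← h3]
  simp [D.ψ_e, smul_smul, mul_comm]

theorem Good.Q2 {η : H →ₐ[k] H} (hη : D.Good η) (A y : H) (n : ι) :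
    D.ad (D.ad (η A) y) (D.S (D.e n)) = D.sw (fun i j => D.sw (fun a l =>
      D.ad (η (D.e i)) (D.χ j (D.e a)) * D.S (D.e n) * D.ψ n (D.ad (η (D.e j)) (D.S (D.e l)))) y) A := by
  have h1 : D.ad (D.ad (η A) y) (D.S (D.e n)) = D.sw (fun i j => D.ad (η (D.e i))
      (D.ad (D.χ j y) (D.ad (D.S (η (D.e j))) (D.S (D.e n))))) A := by
    rw [hη.ad0]
    refine (D.map_sw (D.ad.flip (D.S (D.e n))) _ A).trans ?_
    apply sw_congr; intro i j
    rw [L1, L1, LinearMap.flip_apply, mul_assoc]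
  have h2 : ∀ j, D.ad (D.χ j y) (D.ad (D.S (η (D.e j))) (D.S (D.e n))) =
      D.sw (fun a l => D.χ j (D.e a) * (D.ad (D.S (η (D.e j))) (D.S (D.e n)) *
        D.S (D.ψ n (D.e l)))) y := by
    intro j
    rw [(good_χ j).ad0]
    apply sw_congr; intro a l
    rw [(good_χ l).ad, ← D.S_χ, ← D.S_χ, ← hη.χ_comm]
    simp only [D.χ_e, D.ψ_e, map_smul, LinearMap.smul_apply, smul_mul_assoc, mul_smul_comm,
      smul_smul, mul_assoc]
    congr 1
    linear_combination (D.φ l n * D.φ j a) * D.skew l j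
  rw [h1]
  simp only [h2, Cal.map_sw]
  rw [sw_swap]
  conv_rhs => rw [sw_swap]
  apply sw_congr; intro a l
  have h3 : ∀ i j, D.ad (η (D.e i)) (D.χ j (D.e a) * (D.ad (D.S (η (D.e j))) (D.S (D.e n)) *
        D.S (D.ψ n (D.e l)))) = D.sw (fun p q => D.ad (η (D.e p)) (D.e a) *
        D.ad (η (D.ψ a (D.e q))) (D.ad (D.S (η (D.ψ a (D.e j)))) (D.S (D.e n)) *
        D.S (D.ψ n (D.e l)))) (D.e i) := by
    intro i j
    rw [hη.R]
    apply sw_congr; intro p q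
    simp only [D.χ_e, D.ψ_e, map_smul, LinearMap.smul_apply, smul_mul_assoc, mul_smul_comm,
      smul_smul]
    congr 1; ring
  simp only [h3]
  rw [D.coassoc (fun p q j => D.ad (η (D.e p)) (D.e a) *
        D.ad (η (D.ψ a (D.e q))) (D.ad (D.S (η (D.ψ a (D.e j)))) (D.S (D.e n)) *
        D.S (D.ψ n (D.e l))))]
  apply sw_congr; intro i j
  have h4 := (hη.comp (good_ψ a)).klem (D.e j) n (D.S (D.ψ n (D.e l)))
  simp only [AlgHom.comp_apply] at h4
  rw [← mul_sw, h4, (good_ψ n).ad, ← D.S_ψ, ← hη.ψ_comm]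
  simp only [D.χ_e, D.ψ_e, map_smul, LinearMap.smul_apply, smul_mul_assoc, mul_smul_comm,
      smul_smul, mul_assoc]
 

theorem Good.Qψ {η : H →ₐ[k] H} (hη : D.Good η) (X A y : H) :
    D.J X (D.ad (η A) y) = D.sw (fun i j => D.sw (fun a l =>
      D.ad (X * η (D.e i)) (D.χ j (D.e a)) * D.ad (η (D.e j)) (D.S (D.e l))) y) A := by
  rw [J_eq]
  have h1 : ∀ s t, D.e s * D.ad (D.χ t (D.ad (η A) y)) (D.S (D.e t)) =
      D.sw (fun i j => D.sw (fun a l => (D.e s * D.χ t (D.ad (η (D.e i)) (D.χ j (D.e a))) *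
       D.S (D.e t)) * D.ad (η (D.e j)) (D.S (D.e l))) y) A := by
    intro s t
    have h2 : D.ad (D.χ t (D.ad (η A) y)) (D.S (D.e t)) =
        D.φ t t • D.χ t (D.ad (D.ad (η A) y) (D.S (D.e t))) := by
      rw [(good_χ t).ad _ (D.S (D.e t)), ← D.S_χ, D.χ_e, map_smul, map_smul, smul_smul, D.skew,
        one_smul]
    rw [h2, hη.Q2, (good_χ t).map_sw, smul_sw, mul_sw]
    apply sw_congr; intro i j
    rw [(good_χ t).map_sw, smul_sw, mul_sw]
    apply sw_congr; intro a l
    rw [map_mul (D.χ t), map_mul (D.χ t), D.χψ, ← D.S_χ, D.χ_e t t]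
    simp only [map_smul, smul_mul_assoc, mul_smul_comm, smul_smul, D.skew, one_smul, mul_assoc]
  simp only [h1]
  rw [sw_swap]
  apply sw_congr; intro i j
  rw [sw_swap]
  apply sw_congr; intro a l
  rw [← sw_mul, ← ad_apply, L1]

theorem main (a x y : H) : D.ad a (D.J x y) =
    D.sw (fun i j => D.J (D.ad (D.e i) (D.χ j x)) (D.ad (D.e j) y)) a := by
  have : D.ad a ∘ₗ D.J.flip y = D.sw (fun i j =>
      D.J.flip (D.ad (D.e j) y) ∘ₗ D.ad (D.e i) ∘ₗ (D.χ j).toLinearMap) a := by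
    apply D.e.ext; intro h
    rw [sw_app]
    simp only [LinearMap.comp_apply, LinearMap.flip_apply, AlgHom.toLinearMap_apply]
    have h1 : ∀ i j, D.J (D.ad (D.e i) (D.χ j (D.e h))) (D.ad (D.e j) y) =
        D.sw (fun p q => D.sw (fun b l => D.ad (D.ad (D.e i) (D.e h) * D.ψ h (D.e p))
         (D.χ q (D.e b)) * D.ad (D.ψ h (D.e q)) (D.S (D.e l))) y) (D.e j) := by
      intro i j
      rw [← (good_ψ h).Qψ]
      simp only [D.χ_e, D.ψ_e, map_smul, LinearMap.smul_apply]
    simp only [h1]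
    rw [← D.coassoc (fun i p q => D.sw (fun b l => D.ad (D.ad (D.e i) (D.e h) * D.ψ h (D.e p))
         (D.χ q (D.e b)) * D.ad (D.ψ h (D.e q)) (D.S (D.e l))) y)]
    have h2 : ∀ i j, D.sw (fun p q => D.sw (fun b l => D.ad (D.ad (D.e p) (D.e h) * D.ψ h (D.e q))
         (D.χ j (D.e b)) * D.ad (D.ψ h (D.e j)) (D.S (D.e l))) y) (D.e i) =
         D.sw (fun b l => D.ad (D.e i * D.e h)
         (D.χ j (D.e b)) * D.ad (D.ψ h (D.e j)) (D.S (D.e l))) y := by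
      intro i j
      rw [sw_swap]
      apply sw_congr; intro b l
      rw [← L2, ← sw_mul]
      congr 1
      exact (D.map_sw (D.ad.flip (D.χ j (D.e b))) _ (D.e i)).symm
    simp only [h2]
    rw [J_apply, map_sw]
    simp only [R1]
    rw [sw_swap]
    apply sw_congr; intro i j
    apply sw_congr; intro b l
    rw [(good_χ j).ad, L1]
    simp only [D.χ_e, D.ψ_e, map_smul, LinearMap.smul_apply, mul_smul_comm, smul_mul_assoc]
    rw [smul_comm]
  have h := LinearMap.congr_fun this x
  rw [sw_app] at h
  exact h

end Cal
end Part6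

section Part7
set_option linter.unusedSimpArgs false
section Translate
variable {k G ι H : Type*} [Field k] [CommGroup G] [Ring H] [Algebra k H]

theorem swr_gen {M : Type*} [AddCommGroup M] [Module k M] (e : Module.Basis ι k H)
    (Δ : H →ₗ[k] H ⊗[k] H) (f : H ⊗[k] H →ₗ[k] M) (a : H) :
    f (Δ a) = swr e Δ (fun i j => f (e i ⊗ₜ[k] e j)) a := by
  unfold swr
  have : (e.tensorProduct e).constr k
      (fun p : ι × ι => f (e p.1 ⊗ₜ[k] e p.2)) = f := by
    apply (e.tensorProduct e).ext
    rintro ⟨i, j⟩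
    rw [Module.Basis.constr_basis]; simp
  rw [this]; rfl

variable (C : ColorHopfAlg k G H) (e : Module.Basis ι k H) (d : ι → G)

/-- the diagonal map `x ↦ φ(dᵢ,|x|) x` -/
noncomputable def chi (i : ι) : H →ₗ[k] H := e.constr k (fun j => C.φ (d i) (d j) • e j)
/-- the diagonal map `x ↦ φ(|x|,dᵢ) x` -/
noncomputable def psi (i : ι) : H →ₗ[k] H := e.constr k (fun j => C.φ (d j) (d i) • e j)

theorem chi_e (i j : ι) : chi C e d i (e j) = C.φ (d i) (d j) • e j := by
  simp [chi, Module.Basis.constr_basis]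
theorem psi_e (i j : ι) : psi C e d i (e j) = C.φ (d j) (d i) • e j := by
  simp [psi, Module.Basis.constr_basis]

theorem braid_chi (hd : ∀ i, e i ∈ C.grade (d i)) (i : ι) (x : H) : C.braid (e i ⊗ₜ[k] x) = chi C e d i x ⊗ₜ[k] e i := by
  have : C.braid ∘ₗ TensorProduct.mk k H H (e i) =
      (TensorProduct.mk k H H).flip (e i) ∘ₗ chi C e d i := by
    apply e.ext; intro j
    simp [chi_e, C.braid_apply _ _ _ _ (hd i) (hd j), TensorProduct.smul_tmul']
  exact LinearMap.congr_fun this x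

theorem braid_psi (hd : ∀ i, e i ∈ C.grade (d i)) (i : ι) (x : H) : C.braid (x ⊗ₜ[k] e i) = e i ⊗ₜ[k] psi C e d i x := by
  have : C.braid ∘ₗ (TensorProduct.mk k H H).flip (e i) =
      TensorProduct.mk k H H (e i) ∘ₗ psi C e d i := by
    apply e.ext; intro j
    simp [psi_e, C.braid_apply _ _ _ _ (hd j) (hd i)]
  exact LinearMap.congr_fun this x

theorem chi_hom (hd : ∀ i, e i ∈ C.grade (d i)) (i : ι) (g : G) (x : H) (hx : x ∈ C.grade g) :
    chi C e d i x = C.φ (d i) g • x := by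
  have h := braid_chi C e d hd i x
  rw [C.braid_apply _ _ _ _ (hd i) hx] at h
  have := congrArg (fun t => TensorProduct.rid k H
    (TensorProduct.map LinearMap.id (e.coord i) t)) h
  simpa using this.symm

theorem psi_hom (hd : ∀ i, e i ∈ C.grade (d i)) (i : ι) (g : G) (x : H) (hx : x ∈ C.grade g) :
    psi C e d i x = C.φ g (d i) • x := by
  have h := braid_psi C e d hd i x
  rw [C.braid_apply _ _ _ _ hx (hd i)] at h
  have := congrArg (fun t => TensorProduct.lid k H
    (TensorProduct.map (e.coord i) LinearMap.id t)) h
  simpa using this.symm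

theorem phi_one_right (g : G) : C.φ g 1 = 1 := by
  have := C.φ_mul_right g 1 1
  rw [mul_one] at this
  exact (mul_eq_left₀ (C.φ_ne g 1)).1 this.symm

theorem phi_one_left (g : G) : C.φ 1 g = 1 := by
  have := C.φ_mul_left 1 1 g
  rw [mul_one] at this
  exact (mul_eq_left₀ (C.φ_ne 1 g)).1 this.symm

noncomputable def chiA (hd : ∀ i, e i ∈ C.grade (d i))
    (hm : ∀ x y : H, C.mul (x ⊗ₜ[k] y) = x * y) (h1 : C.one = 1) (i : ι) : H →ₐ[k] H := AlgHom.ofLinearMap (chi C e d i)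
  (by rw [← h1, chi_hom C e d hd i 1 _ C.one_mem, phi_one_right, one_smul])
  (by
    intro x y
    have : (LinearMap.mul k H).compr₂ (chi C e d i) =
        (LinearMap.mul k H).compl₁₂ (chi C e d i) (chi C e d i) := by
      apply e.ext; intro p; apply e.ext; intro q
      have := C.mul_mem _ _ _ _ (hd p) (hd q)
      rw [hm] at this
      simp [chi_hom C e d hd i _ _ this, chi_e, C.φ_mul_right, smul_smul, mul_comm]
    exact LinearMap.congr_fun (LinearMap.congr_fun this x) y)

noncomputable def psiA (hd : ∀ i, e i ∈ C.grade (d i))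
    (hm : ∀ x y : H, C.mul (x ⊗ₜ[k] y) = x * y) (h1 : C.one = 1) (i : ι) : H →ₐ[k] H := AlgHom.ofLinearMap (psi C e d i)
  (by rw [← h1, psi_hom C e d hd i 1 _ C.one_mem, phi_one_left, one_smul])
  (by
    intro x y
    have : (LinearMap.mul k H).compr₂ (psi C e d i) =
        (LinearMap.mul k H).compl₁₂ (psi C e d i) (psi C e d i) := by
      apply e.ext; intro p; apply e.ext; intro q
      have := C.mul_mem _ _ _ _ (hd p) (hd q)
      rw [hm] at this
      simp [psi_hom C e d hd i _ _ this, psi_e, C.φ_mul_left, smul_smul, mul_comm]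
    exact LinearMap.congr_fun (LinearMap.congr_fun this x) y)

noncomputable def calOf (hd : ∀ i, e i ∈ C.grade (d i))
    (hm : ∀ x y : H, C.mul (x ⊗ₜ[k] y) = x * y) (h1 : C.one = 1) : Cal k ι H where
  e := e
  φ i j := C.φ (d i) (d j)
  skew i j := C.φ_skew _ _
  χ := chiA C e d hd hm h1
  ψ := psiA C e d hd hm h1
  χ_e i j := chi_e C e d i j
  ψ_e i j := psi_e C e d i j
  Δ := C.comul
  S := C.antipode
  ε := C.counit
  S_χ i x := by
    have : C.antipode ∘ₗ chi C e d i = chi C e d i ∘ₗ C.antipode := by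
      apply e.ext; intro j
      simp [chi_e, chi_hom C e d hd i _ _ (C.antipode_mem _ _ (hd j))]
    exact LinearMap.congr_fun this x
  coassoc0 := C.coassoc
  counit_left0 := C.counit_left
  counit_right0 := C.counit_right
  comul_one := by rw [← h1]; exact C.comul_one
  counit_one := by rw [← h1]; exact C.counit_one
  counit_mul x y := by rw [← hm]; exact C.counit_mul x y
  comul_mul0 a b := by
    rw [← hm]
    refine (LinearMap.congr_fun C.comul_mul (a ⊗ₜ[k] b)).trans ?_
    simp only [LinearMap.comp_apply, TensorProduct.map_tmul]
    refine (swr_gen e C.comul ((TensorProduct.map C.mul C.mul) ∘ₗ midMap k C.braid ∘ₗ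
      (TensorProduct.mk k _ _).flip (C.comul b)) a).trans ?_
    congr 2
    funext i j
    refine (swr_gen e C.comul ((TensorProduct.map C.mul C.mul) ∘ₗ midMap k C.braid ∘ₗ
      (TensorProduct.mk k _ _) (e i ⊗ₜ[k] e j)) b).trans ?_
    congr 2
    funext p q
    simp [midMap, braid_chi C e d hd, hm]
    rfl
  cocomm0 a := by
    refine (LinearMap.congr_fun C.cocomm a).symm.trans ?_
    refine (swr_gen e C.comul C.braid a).trans ?_
    congr 2
    funext i j
    exact C.braid_apply _ _ _ _ (hd i) (hd j)
  antipode_left0 x := by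
    have h := C.antipode_left x
    rw [h1] at h
    rw [← h]
    refine ((swr_gen e C.comul (C.mul ∘ₗ (TensorProduct.map C.antipode LinearMap.id)) x).trans ?_).symm
    simp [hm]
  antipode_right0 x := by
    have h := C.antipode_right x
    rw [h1] at h
    rw [← h]
    refine ((swr_gen e C.comul (C.mul ∘ₗ (TensorProduct.map LinearMap.id C.antipode)) x).trans ?_).symm
    simp [hm]

end Translate
end Part7

section Part8
set_option linter.unusedSimpArgs false
section Core

theorem Cal.sw_mem {k ι H M : Type*} [Field k] [Ring H] [Algebra k H] (D : Cal k ι H)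
    [AddCommGroup M] [Module k M] (K : Submodule k M) (F : ι → ι → M) (a : H)
    (h : ∀ i j, F i j ∈ K) : D.sw F a ∈ K := by
  rw [D.sw_eq]
  exact Submodule.sum_mem _ (fun p _ => K.smul_mem _ (h _ _))

theorem core {k G H : Type*} [Field k] [CommGroup G] [Ring H] [Algebra k H]
    (C : ColorHopfAlg k G H)
    (hm : ∀ x y : H, C.mul (x ⊗ₜ[k] y) = x * y) (h1 : C.one = 1)
    (V W : Submodule k H) (hV : C.IsCHSub V) (hW : C.IsCHSub W)
    (hVn : C.IsNormal V) (hWn : C.IsNormal W) :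
    (∀ a : H, C.homogeneous a → ∀ x ∈ V, ∀ y ∈ W,
      C.adj (a ⊗ₜ[k] C.commMap (x ⊗ₜ[k] y)) =
        (C.commMap ∘ₗ (TensorProduct.map C.adj C.adj) ∘ₗ midMap k C.braid ∘ₗ
          (TensorProduct.map C.comul LinearMap.id)) (a ⊗ₜ[k] (x ⊗ₜ[k] y))) ∧
    C.IsNormal (C.commSub V W) := by
  have hspan : (⊤ : Submodule k H) ≤ Submodule.span k (⋃ g, (C.grade g : Set H)) := by
    rw [← Submodule.iSup_eq_span, C.grade_top]
  let e := Module.Basis.ofSpan hspan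
  have hex : ∀ i, ∃ g, e i ∈ C.grade g := fun i => by
    have := Module.Basis.ofSpan_subset hspan ⟨i, rfl⟩
    exact Set.mem_iUnion.1 this
  choose d hd using hex
  let D := calOf C e d hd hm h1
  have hDe : D.e = e := rfl
  have hbr : ∀ i x, C.braid (D.e i ⊗ₜ[k] x) = D.χ i x ⊗ₜ[k] D.e i :=
    fun i x => braid_chi C e d hd i x
  have hχ : ∀ i g x, x ∈ C.grade g → D.χ i x = C.φ (d i) g • x :=
    fun i g x hx => chi_hom C e d hd i g x hx
  have hψ : ∀ i g x, x ∈ C.grade g → D.ψ i x = C.φ g (d i) • x :=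
    fun i g x hx => psi_hom C e d hd i g x hx
  have hΔ : C.comul = D.Δ := rfl
  have hS : C.antipode = D.S := rfl
  clear_value D
  have hadj : ∀ a x, C.adj (a ⊗ₜ[k] x) = D.ad a x := by
    intro a x
    rw [D.ad_apply]
    simp only [ColorHopfAlg.adj, LinearMap.comp_apply, TensorProduct.map_tmul, hΔ]
    refine (D.sw_tmul_gen (C.mul ∘ₗ
      (TensorProduct.map LinearMap.id
      (C.mul ∘ₗ (TensorProduct.map LinearMap.id C.antipode) ∘ₗ C.braid)) ∘ₗ
      (TensorProduct.assoc k H H H).toLinearMap ∘ₗ (TensorProduct.mk k _ _).flip x) a).trans ?_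
    apply D.sw_congr; intro i j
    simp [hbr, hm, hS, mul_assoc]
  have hcomm : ∀ x y, C.commMap (x ⊗ₜ[k] y) = D.J x y := by
    intro x y
    rw [D.J_apply]
    simp only [ColorHopfAlg.commMap, LinearMap.comp_apply, TensorProduct.map_tmul, hΔ]
    refine (D.sw_tmul_gen (C.mul ∘ₗ (TensorProduct.map C.adj C.antipode) ∘ₗ
      (TensorProduct.assoc k H H H).symm.toLinearMap ∘ₗ (TensorProduct.mk k _ _) x) y).trans ?_
    apply D.sw_congr; intro i j
    simp [hadj, hm, hS]
  refine ⟨?_, ?_⟩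
  · intro a _ x _ y _
    rw [hadj, hcomm, D.main]
    simp only [LinearMap.comp_apply, TensorProduct.map_tmul, hΔ]
    symm
    refine (D.sw_tmul_gen (C.commMap ∘ₗ (TensorProduct.map C.adj C.adj) ∘ₗ midMap k C.braid ∘ₗ
      (TensorProduct.mk k _ _).flip (x ⊗ₜ[k] y)) a).trans ?_
    apply D.sw_congr; intro i j
    simp [midMap, hbr, hadj, hcomm]
  -- diagonal maps preserve graded subspaces
  have hχV : ∀ U : Submodule k H, C.IsCHSub U → ∀ i, ∀ x ∈ U, D.χ i x ∈ U := by
    intro U hU i x hx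
    have := hU.graded x hx
    refine Submodule.span_induction (p := fun x _ => D.χ i x ∈ U) ?_ ?_ ?_ ?_ this
    · rintro y ⟨hy, g, hg⟩
      rw [hχ i g y hg]; exact U.smul_mem _ hy
    · simp
    · intro x y _ _ h h'; rw [map_add]; exact U.add_mem h h'
    · intro c x _ h; rw [map_smul]; exact U.smul_mem _ h
  set K := C.commSub V W with hK
  have Kgen : ∀ x ∈ V, ∀ y ∈ W, D.J x y ∈ K := by
    intro x hx y hy
    rw [hK, ColorHopfAlg.commSub, ColorHopfAlg.genFrom, Submodule.mem_sInf]
    rintro U ⟨h, -⟩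
    exact h ⟨x, hx, y, hy, (hcomm x y).symm⟩
  have Kone : (1 : H) ∈ K := by
    rw [hK, ColorHopfAlg.commSub, ColorHopfAlg.genFrom, Submodule.mem_sInf]
    rintro U ⟨-, h, -⟩
    rwa [h1] at h
  have Kmul : ∀ x ∈ K, ∀ y ∈ K, x * y ∈ K := by
    intro x hx y hy
    rw [hK, ColorHopfAlg.commSub, ColorHopfAlg.genFrom, Submodule.mem_sInf] at hx hy ⊢
    intro U hU
    have := hU.2.2 x (hx U hU) y (hy U hU)
    rwa [hm] at this
  have Kind : ∀ U : Submodule k H, (∀ x ∈ V, ∀ y ∈ W, D.J x y ∈ U) → (1 : H) ∈ U →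
      (∀ x ∈ U, ∀ y ∈ U, x * y ∈ U) → K ≤ U := by
    intro U a1 a2 a3
    refine sInf_le ⟨?_, ?_, ?_⟩
    · rintro z ⟨x, hx, y, hy, rfl⟩
      rw [hcomm]; exact a1 x hx y hy
    · rwa [h1]
    · intro x hx y hy; rw [hm]; exact a3 x hx y hy
  have Kχ : ∀ i, ∀ x ∈ K, D.χ i x ∈ K := by
    intro i
    refine Kind (K.comap (D.χ i).toLinearMap) ?_ ?_ ?_
    · intro x hx y hy
      rw [Submodule.mem_comap, AlgHom.toLinearMap_apply, (Cal.good_χ i).J]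
      exact Kgen _ (hχV V hV i x hx) _ (hχV W hW i y hy)
    · rw [Submodule.mem_comap, AlgHom.toLinearMap_apply, map_one]; exact Kone
    · intro x hx y hy
      rw [Submodule.mem_comap, AlgHom.toLinearMap_apply, map_mul]
      exact Kmul _ hx _ hy
  have Kad : K ≤ ⨅ a, K.comap (D.ad a) := by
    refine Kind _ ?_ ?_ ?_
    · intro x hx y hy
      rw [Submodule.mem_iInf]; intro a
      rw [Submodule.mem_comap, D.main]
      apply D.sw_mem; intro i j
      apply Kgen
      · rw [← hadj]; exact hVn _ _ (hχV V hV j x hx)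
      · rw [← hadj]; exact hWn _ _ hy
    · rw [Submodule.mem_iInf]; intro a
      rw [Submodule.mem_comap, D.ad_one]
      exact K.smul_mem _ Kone
    · intro x hx y hy
      rw [Submodule.mem_iInf] at hx hy ⊢; intro a
      rw [Submodule.mem_comap, D.R1]
      apply D.sw_mem; intro i j
      apply Kmul
      · have : D.ad (D.e i) (D.χ j x) = D.χ j (D.ad (D.ψ j (D.e i)) x) := by
          rw [(Cal.good_χ j).ad, D.χψ]
        rw [this]
        exact Kχ j _ (hx _)
      · exact hy _
  intro a x hx
  rw [hadj]
  exact (Submodule.mem_iInf _).1 (Kad hx) a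

/-- the ring structure of a color Hopf algebra -/
abbrev ringOf {k G H : Type*} [Field k] [CommGroup G] [inst : AddCommGroup H] [Module k H]
    (C : ColorHopfAlg k G H) : Ring H :=
  { inst with
    mul := fun x y => C.mul (x ⊗ₜ[k] y)
    one := C.one
    mul_assoc := C.mul_assoc'
    one_mul := C.one_mul'
    mul_one := C.mul_one'
    left_distrib := fun x y z => by
      change C.mul _ = C.mul _ + C.mul _
      rw [TensorProduct.tmul_add, map_add]
    right_distrib := fun x y z => by
      change C.mul _ = C.mul _ + C.mul _
      rw [TensorProduct.add_tmul, map_add]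
    zero_mul := fun x => by
      change C.mul _ = _
      rw [TensorProduct.zero_tmul, map_zero]
    mul_zero := fun x => by
      change C.mul _ = _
      rw [TensorProduct.tmul_zero, map_zero] }

abbrev algOf {k G H : Type*} [Field k] [CommGroup G] [AddCommGroup H] [inst : Module k H]
    (C : ColorHopfAlg k G H) : @Algebra k H _ (ringOf C).toSemiring :=
  @Algebra.ofModule k H _ (ringOf C).toSemiring inst
    (fun r x y => by
      change C.mul _ = r • C.mul _
      rw [← map_smul, TensorProduct.smul_tmul'])
    (fun r x y => by
      change C.mul _ = r • C.mul _
      rw [← map_smul, TensorProduct.tmul_smul])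

end Core
end Part8

section Statements

variable {H : Type*} [AddCommGroup H] [Module k H]

/-- `[X,Y]` is normal in `A`; explicitly
`a ▷ [x,y] = φ(|a₂|,|x|) [a₁ ▷ x, a₂ ▷ y]` for homogeneous `a`. -/
theorem commutator_normal (C : ColorHopfAlg k G H)
    (V W : Submodule k H) (hV : C.IsCHSub V) (hW : C.IsCHSub W)
    (hVn : C.IsNormal V) (hWn : C.IsNormal W) :
    (∀ a : H, C.homogeneous a → ∀ x ∈ V, ∀ y ∈ W,
      C.adj (a ⊗ₜ[k] C.commMap (x ⊗ₜ[k] y)) =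
        (C.commMap ∘ₗ (TensorProduct.map C.adj C.adj) ∘ₗ midMap k C.braid ∘ₗ
          (TensorProduct.map C.comul LinearMap.id)) (a ⊗ₜ[k] (x ⊗ₜ[k] y))) ∧
    C.IsNormal (C.commSub V W) := by
  exact @core k G H _ _ (ringOf C) (algOf C) C (fun _ _ => rfl) rfl V W hV hW hVn hWn

end Statements

end ColorHopfPaper
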